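/- arXiv:1304.2191 — 2 statements merged into one kernel-verified Lean document; each statement's English description precedes it below -/
import Mathlib

section
/- Let S be a nonempty finite set of positive integers, let T = S \ {m² : m a positive integer}, let 𝒯 = {π_odd(z) : z ∈ T}, let A = ⋃{X : X ∈ 𝒯}, let n = |A|, and let d be the dimension of the linear span of v(𝒯) in Fⁿ, where F is the field with 2 elements. Then the set of odd primes p, not dividing any element of S, such that χ_p(z) = 1 for all z ∈ S, has density 2^{−d} in the set of all primes. -/
open scoped Classical

/-- The density of a set `P` of primes within the set of all primes. -/
def HasPrimeDensity (P : Set ℕ) (δ : ℝ) : Prop :=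
  Filter.Tendsto
    (fun x : ℕ => (({p ∈ P | p ≤ x}.ncard : ℝ) / ({p | Nat.Prime p ∧ p ≤ x}.ncard : ℝ)))
    Filter.atTop (nhds δ)

/-- The set `π_odd(z)` of prime factors of `z` of odd multiplicity. -/
def piOdd (z : ℕ) : Finset ℕ :=
  z.primeFactors.filter (fun q => Odd (z.factorization q))

/-- For a finite set `A` of naturals with `A.card = n`, listing the elements of `A` in
increasing order, `indVec A h S` is the indicator vector in `F^n` (over the field `F` of two
elements) of the subset `S ⊆ A`. -/
noncomputable def indVec {n : ℕ} (A : Finset ℕ) (h : A.card = n) (S : Finset ℕ) :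
    Fin n → ZMod 2 :=
  fun i => if (↑(A.orderIsoOfFin h i) : ℕ) ∈ S then 1 else 0

section Tauberian

open MeasureTheory Filter Topology Set FourierTransform

/-- The triangle function, whose Fourier transform is the Fejér kernel. -/
noncomputable def triangle (s : ℝ) : ℝ := max (1 - |s|) 0

lemma continuous_triangle : Continuous triangle := by
  unfold triangle; fun_prop

lemma triangle_nonneg (s : ℝ) : 0 ≤ triangle s := le_max_right _ _

lemma triangle_eq_zero {s : ℝ} (hs : 1 ≤ |s|) : triangle s = 0 :=
  max_eq_right (by linarith)

lemma hasCompactSupport_triangle : HasCompactSupport triangle :=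
  HasCompactSupport.intro (isCompact_Icc (a := (-1 : ℝ)) (b := 1)) fun s hs ↦
    triangle_eq_zero <| by
      by_contra! h
      exact hs ⟨(abs_lt.mp h).1.le, (abs_lt.mp h).2.le⟩

lemma integrable_triangle : Integrable triangle :=
  continuous_triangle.integrable_of_hasCompactSupport hasCompactSupport_triangle

lemma integral_mul_triangle (f : ℝ → ℂ) (hf : Continuous f) :
    ∫ s, f s * (triangle s : ℂ) =
      (∫ s in (-1 : ℝ)..0, f s * (1 + s)) + ∫ s in (0 : ℝ)..1, f s * (1 - s) := by
  have h1 : ∫ s, f s * (triangle s : ℂ) = ∫ s in (-1 : ℝ)..1, f s * (triangle s : ℂ) := by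
    rw [intervalIntegral.integral_of_le (by norm_num), ← integral_Icc_eq_integral_Ioc]
    refine (setIntegral_eq_integral_of_forall_compl_eq_zero fun s hs ↦ ?_).symm
    rw [triangle_eq_zero, Complex.ofReal_zero, mul_zero]
    by_contra! h
    exact hs ⟨(abs_lt.mp h).1.le, (abs_lt.mp h).2.le⟩
  have hc : Continuous fun s ↦ f s * (triangle s : ℂ) :=
    hf.mul (Complex.continuous_ofReal.comp continuous_triangle)
  rw [h1, ← intervalIntegral.integral_add_adjacent_intervals (b := 0)
    (hc.intervalIntegrable _ _) (hc.intervalIntegrable _ _)]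
  congr 1
  · refine intervalIntegral.integral_congr fun s hs ↦ ?_
    rw [uIcc_of_le (by norm_num)] at hs
    simp only [triangle, abs_of_nonpos hs.2]
    rw [max_eq_left (by linarith [hs.1])]
    push_cast; ring
  · refine intervalIntegral.integral_congr fun s hs ↦ ?_
    rw [uIcc_of_le (by norm_num)] at hs
    simp only [triangle, abs_of_nonneg hs.1]
    rw [max_eq_left (by linarith [hs.2])]
    push_cast; ring

lemma integral_exp_mul_triangle {c : ℂ} (hc : c ≠ 0) :
    ∫ s : ℝ, Complex.exp (c * s) * (triangle s : ℂ) =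
      (Complex.exp c + Complex.exp (-c) - 2) / c ^ 2 := by
  have he (s : ℝ) : HasDerivAt (fun s : ℝ ↦ Complex.exp (c * s)) (Complex.exp (c * s) * c) s := by
    have : HasDerivAt (fun s : ℝ ↦ c * (s : ℂ)) c s := by
      simpa using (Complex.ofRealCLM.hasDerivAt (x := s)).const_mul c
    exact this.cexp
  have hid (s : ℝ) : HasDerivAt (fun s : ℝ ↦ (s : ℂ)) 1 s := Complex.ofRealCLM.hasDerivAt
  rw [integral_mul_triangle _ (by fun_prop)]
  rw [intervalIntegral.integral_eq_sub_of_hasDerivAt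
      (f := fun s : ℝ ↦ Complex.exp (c * s) * (1 + s) / c - Complex.exp (c * s) / c ^ 2),
    intervalIntegral.integral_eq_sub_of_hasDerivAt
      (f := fun s : ℝ ↦ Complex.exp (c * s) * (1 - s) / c + Complex.exp (c * s) / c ^ 2)]
  · simp
    field_simp
    ring
  · intro s _
    convert! (((he s).mul ((hid s).const_sub 1)).div_const c).add ((he s).div_const (c ^ 2)) using 1
    field_simp
    ring
  · exact Continuous.intervalIntegrable (by fun_prop) _ _
  · intro s _
    convert! (((he s).mul ((hid s).const_add 1)).div_const c).sub ((he s).div_const (c ^ 2)) using 1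
    field_simp
    ring
  · exact Continuous.intervalIntegrable (by fun_prop) _ _

/-- The Fejér kernel. -/
noncomputable def fejer (u : ℝ) : ℝ := Real.sinc (Real.pi * u) ^ 2

lemma fejer_nonneg (u : ℝ) : 0 ≤ fejer u := sq_nonneg _

lemma continuous_fejer : Continuous fejer := by
  unfold fejer
  exact (Real.continuous_sinc.comp (by fun_prop)).pow 2

lemma fourier_triangle (u : ℝ) : 𝓕 (fun s ↦ (triangle s : ℂ)) u = fejer u := by
  rw [Real.fourier_real_eq_integral_exp_smul]
  rcases eq_or_ne u 0 with rfl | hu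
  · simp only [mul_zero, Complex.ofReal_zero, zero_mul, smul_eq_mul, fejer, Real.sinc_zero]
    rw [integral_mul_triangle _ (by fun_prop)]
    simp only [Complex.exp_zero, one_mul]
    have h1 : ∫ s in (-1 : ℝ)..0, (1 + (s : ℂ)) = 1 / 2 := by
      have : ∫ s in (-1 : ℝ)..0, (1 + s) = 1 / 2 := by
        rw [intervalIntegral.integral_add (by simp) (by simp)]
        simp; norm_num
      rw [show (1 / 2 : ℂ) = ((1 / 2 : ℝ) : ℂ) by simp, ← this, ← intervalIntegral.integral_ofReal]
      simp
    have h2 : ∫ s in (0 : ℝ)..1, (1 - (s : ℂ)) = 1 / 2 := by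
      have : ∫ s in (0 : ℝ)..1, (1 - s) = 1 / 2 := by
        rw [intervalIntegral.integral_sub (by simp) (by simp)]
        simp; norm_num
      rw [show (1 / 2 : ℂ) = ((1 / 2 : ℝ) : ℂ) by simp, ← this, ← intervalIntegral.integral_ofReal]
      simp
    rw [h1, h2]
    norm_num
  · have hπ : (Real.pi : ℂ) ≠ 0 := by exact_mod_cast Real.pi_ne_zero
    have huc : (u : ℂ) ≠ 0 := by exact_mod_cast hu
    have key := integral_exp_mul_triangle (c := -2 * Real.pi * u * Complex.I)
      (by simp [hπ, huc])
    calc _ = ∫ s : ℝ, Complex.exp (-2 * Real.pi * u * Complex.I * s) * (triangle s : ℂ) := by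
          refine integral_congr_ae (.of_forall fun s ↦ ?_)
          simp only [smul_eq_mul]
          congr 2
          push_cast; ring
      _ = _ := key
      _ = _ := by
        rw [fejer, Real.sinc_of_ne_zero (mul_ne_zero Real.pi_ne_zero hu)]
        push_cast
        have h3 : Complex.exp (-2 * Real.pi * u * Complex.I) +
            Complex.exp (-(-2 * Real.pi * u * Complex.I)) = 2 * Complex.cos (2 * (Real.pi * u)) := by
          rw [Complex.two_cos, add_comm]
          congr 2 <;> ring
        rw [h3, Complex.cos_two_mul, Complex.cos_sq', div_pow]
        have h4 : (-2 * Real.pi * u * Complex.I : ℂ) ^ 2 = -4 * (Real.pi * u) ^ 2 := by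
          rw [mul_pow, Complex.I_sq]; ring
        rw [h4]
        field_simp
        ring

lemma fejer_le (u : ℝ) : fejer u ≤ 2 * (1 + u ^ 2)⁻¹ := by
  rw [← div_eq_mul_inv, le_div_iff₀ (by positivity), mul_add, mul_one]
  have h1 : fejer u ≤ 1 := by
    rw [fejer, sq_le_one_iff_abs_le_one]
    exact Real.abs_sinc_le_one _
  have h2 : fejer u * u ^ 2 ≤ 1 := by
    rcases eq_or_ne u 0 with rfl | hu
    · simp
    · rw [fejer, Real.sinc_of_ne_zero (mul_ne_zero Real.pi_ne_zero hu), div_pow, mul_pow]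
      have : 1 ≤ Real.pi ^ 2 := by nlinarith [Real.pi_gt_three]
      have hs := Real.sin_sq_le_one (Real.pi * u)
      field_simp
      linarith
  linarith

lemma integrable_fejer : Integrable fejer := by
  refine (integrable_inv_one_add_sq.const_mul 2).mono' continuous_fejer.aestronglyMeasurable
    (.of_forall fun u ↦ ?_)
  rw [Real.norm_of_nonneg (fejer_nonneg u)]
  exact fejer_le u

lemma integral_fejer : ∫ u, fejer u = 1 := by
  have hF : 𝓕 (fun s ↦ (triangle s : ℂ)) = fun u ↦ (fejer u : ℂ) := funext fourier_triangle
  have h := congrFun (Continuous.fourierInv_fourier_eq (f := fun s ↦ (triangle s : ℂ))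
    (Complex.continuous_ofReal.comp continuous_triangle) integrable_triangle.ofReal
    (by rw [hF]; exact integrable_fejer.ofReal)) 0
  rw [hF, Real.fourierInv_eq'] at h
  simp only [inner_zero_right, mul_zero, Complex.ofReal_zero, zero_mul, Complex.exp_zero, one_smul,
    triangle, abs_zero, sub_zero] at h
  rw [integral_complex_ofReal] at h
  simpa using h

lemma fejer_eq_integral (u : ℝ) :
    (fejer u : ℂ) = ∫ s : ℝ, Complex.exp (((-2 * Real.pi * s * u : ℝ) : ℂ) * Complex.I) *
      (triangle s : ℂ) := by
  rw [← fourier_triangle, Real.fourier_real_eq_integral_exp_smul]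
  simp only [smul_eq_mul]

lemma integral_laplace_mul_fejer {h : ℝ → ℝ} (hm : Measurable h) {M : ℝ} (hM : ∀ t, |h t| ≤ M)
    {g : ℂ → ℂ}
    (hL : ∀ z : ℂ, 0 < z.re → ∫ t in Ioi (0 : ℝ), (h t : ℂ) * Complex.exp (-z * t) = g z)
    (y : ℝ) {ε : ℝ} (hε : 0 < ε) :
    ∫ t in Ioi (0 : ℝ), ((h t * Real.exp (-ε * t) * fejer (t - y) : ℝ) : ℂ) =
      ∫ s : ℝ, Complex.exp (((2 * Real.pi * s * y : ℝ) : ℂ) * Complex.I) * (triangle s : ℂ) *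
        g (ε + 2 * Real.pi * s * Complex.I) := by
  have h_int : Integrable (fun t ↦ ((h t * Real.exp (-ε * t) : ℝ) : ℂ))
      (volume.restrict (Ioi (0 : ℝ))) :=
    ((integrableOn_exp_mul_Ioi (neg_lt_zero.mpr hε) 0).bdd_mul hm.aestronglyMeasurable
      (.of_forall fun t ↦ by rw [Real.norm_eq_abs]; exact hM t)).ofReal
  have hprod : Integrable (Function.uncurry fun (t s : ℝ) ↦
      Complex.exp (((-2 * Real.pi * s * (t - y) : ℝ) : ℂ) * Complex.I) *
        (((h t * Real.exp (-ε * t) : ℝ) : ℂ) * (triangle s : ℂ)))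
      ((volume.restrict (Ioi (0 : ℝ))).prod volume) := by
    refine (h_int.mul_prod integrable_triangle.ofReal).bdd_mul (c := 1) ?_ (.of_forall fun p ↦ ?_)
    · exact Continuous.aestronglyMeasurable (by fun_prop)
    · rw [Complex.norm_exp_ofReal_mul_I]
  calc _ = ∫ t in Ioi (0 : ℝ), ∫ s : ℝ,
        Complex.exp (((-2 * Real.pi * s * (t - y) : ℝ) : ℂ) * Complex.I) *
        (((h t * Real.exp (-ε * t) : ℝ) : ℂ) * (triangle s : ℂ)) := by
        refine integral_congr_ae (.of_forall fun t ↦ ?_)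
        simp only
        rw [Complex.ofReal_mul, fejer_eq_integral, ← integral_const_mul]
        refine integral_congr_ae (.of_forall fun s ↦ ?_)
        simp only
        ring
    _ = _ := by
        rw [integral_integral_swap hprod]
        refine integral_congr_ae (.of_forall fun s ↦ ?_)
        simp only
        rw [← hL _ (by simpa using hε), ← integral_const_mul]
        refine integral_congr_ae (.of_forall fun t ↦ ?_)
        simp only
        push_cast
        have e1 : Complex.exp (-2 * Real.pi * s * (t - y) * Complex.I) * Complex.exp (-ε * t) =
            Complex.exp (2 * Real.pi * s * y * Complex.I) *
              Complex.exp (-(ε + 2 * Real.pi * s * Complex.I) * t) := by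
          rw [← Complex.exp_add, ← Complex.exp_add]
          congr 1; ring
        linear_combination (h t * triangle s : ℂ) * e1

/-- If the Laplace transform of a bounded function extends continuously to the closed right
half-plane, then the averages of the function against translates of the Fejér kernel tend to
zero. -/
theorem tendsto_integral_mul_fejer {h : ℝ → ℝ} (hm : Measurable h) {M : ℝ} (hM : ∀ t, |h t| ≤ M)
    {g : ℂ → ℂ} (hg : ContinuousOn g {z | 0 ≤ z.re})
    (hL : ∀ z : ℂ, 0 < z.re → ∫ t in Ioi (0 : ℝ), (h t : ℂ) * Complex.exp (-z * t) = g z) :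
    Tendsto (fun y ↦ ∫ t in Ioi (0 : ℝ), h t * fejer (t - y)) atTop (𝓝 0) := by
  have hmap (s : ℝ) : Tendsto (fun ε : ℝ ↦ (ε + 2 * Real.pi * s * Complex.I : ℂ)) (𝓝[>] 0)
      (𝓝[{z | 0 ≤ z.re}] (2 * Real.pi * s * Complex.I)) := by
    refine tendsto_nhdsWithin_iff.mpr ⟨?_, ?_⟩
    · have : Continuous fun ε : ℝ ↦ (ε + 2 * Real.pi * s * Complex.I : ℂ) := by fun_prop
      simpa using (this.tendsto 0).mono_left nhdsWithin_le_nhds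
    · filter_upwards [self_mem_nhdsWithin] with ε hε
      simpa using (mem_Ioi.mp hε).le
  obtain ⟨C, hC⟩ : ∃ C, ∀ z ∈ Icc (0 : ℝ) 1 ×ℂ Icc (-(2 * Real.pi)) (2 * Real.pi), ‖g z‖ ≤ C :=
    (isCompact_Icc.reProdIm isCompact_Icc).exists_bound_of_continuousOn
      (hg.mono fun z hz ↦ hz.1.1)
  have hC0 : 0 ≤ C := (norm_nonneg _).trans
    (hC 0 (by constructor <;> simp [Real.pi_pos.le]))
  have key (y : ℝ) : ((∫ t in Ioi (0 : ℝ), h t * fejer (t - y) : ℝ) : ℂ) =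
      ∫ s : ℝ, Complex.exp (((2 * Real.pi * s * y : ℝ) : ℂ) * Complex.I) * (triangle s : ℂ) *
        g (2 * Real.pi * s * Complex.I) := by
    refine tendsto_nhds_unique (f := fun ε : ℝ ↦
      ∫ t in Ioi (0 : ℝ), ((h t * Real.exp (-ε * t) * fejer (t - y) : ℝ) : ℂ))
      (l := 𝓝[>] 0) ?_ ?_
    · rw [← integral_complex_ofReal]
      refine tendsto_integral_filter_of_dominated_convergence (fun t ↦ M * fejer (t - y)) ?_ ?_ ?_ ?_
      · refine .of_forall fun ε ↦ Measurable.aestronglyMeasurable ?_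
        have := continuous_fejer.measurable
        fun_prop
      · filter_upwards [self_mem_nhdsWithin] with ε hε
        filter_upwards [ae_restrict_mem measurableSet_Ioi] with t ht
        rw [Complex.norm_real, Real.norm_eq_abs, abs_mul, abs_mul,
          abs_of_nonneg (fejer_nonneg _), Real.abs_exp]
        have h1 : Real.exp (-ε * t) ≤ 1 := by
          rw [Real.exp_le_one_iff]
          nlinarith [mem_Ioi.mp hε, mem_Ioi.mp ht]
        refine mul_le_mul_of_nonneg_right ?_ (fejer_nonneg _)
        calc |h t| * Real.exp (-ε * t) ≤ |h t| * 1 := by gcongr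
          _ ≤ M := by simpa using hM t
      · exact ((integrable_fejer.comp_sub_right y).const_mul M).restrict
      · refine .of_forall fun t ↦ ?_
        have : Continuous fun ε : ℝ ↦ ((h t * Real.exp (-ε * t) * fejer (t - y) : ℝ) : ℂ) := by
          fun_prop
        simpa using (this.tendsto 0).mono_left nhdsWithin_le_nhds
    · have : Tendsto (fun ε : ℝ ↦ ∫ s : ℝ,
          Complex.exp (((2 * Real.pi * s * y : ℝ) : ℂ) * Complex.I) * (triangle s : ℂ) *
            g (ε + 2 * Real.pi * s * Complex.I)) (𝓝[>] 0)
          (𝓝 (∫ s : ℝ, Complex.exp (((2 * Real.pi * s * y : ℝ) : ℂ) * Complex.I) *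
            (triangle s : ℂ) * g (2 * Real.pi * s * Complex.I))) := by
        refine tendsto_integral_filter_of_dominated_convergence (fun s ↦ C * triangle s) ?_ ?_ ?_ ?_
        · filter_upwards [self_mem_nhdsWithin] with ε hε
          refine Continuous.aestronglyMeasurable ?_
          have h1 : Continuous fun s : ℝ ↦ g (ε + 2 * Real.pi * s * Complex.I) :=
            hg.comp_continuous (by fun_prop) fun s ↦ by simpa using (mem_Ioi.mp hε).le
          have h2 : Continuous fun s : ℝ ↦ (triangle s : ℂ) :=
            Complex.continuous_ofReal.comp continuous_triangle
          exact (Continuous.mul (by fun_prop) h2).mul h1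
        · filter_upwards [Ioo_mem_nhdsGT (zero_lt_one (α := ℝ))] with ε hε
          refine .of_forall fun s ↦ ?_
          rw [norm_mul, norm_mul, Complex.norm_exp_ofReal_mul_I, one_mul, Complex.norm_real,
            Real.norm_of_nonneg (triangle_nonneg s), mul_comm]
          by_cases hs : 1 ≤ |s|
          · simp [triangle_eq_zero hs]
          · refine mul_le_mul_of_nonneg_right (hC _ ⟨?_, ?_⟩) (triangle_nonneg s)
            · simpa using ⟨hε.1.le, hε.2.le⟩
            · have := abs_le.mp (not_le.mp hs).le
              simp only [mem_preimage, Complex.add_im, Complex.ofReal_im, zero_add]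
              simp
              constructor <;> nlinarith [Real.pi_pos]
        · exact integrable_triangle.const_mul C
        · refine .of_forall fun s ↦ ?_
          exact ((hg _ (by simp)).tendsto.comp (hmap s)).const_mul _
      refine this.congr' ?_
      filter_upwards [self_mem_nhdsWithin] with ε hε
      exact (integral_laplace_mul_fejer hm hM hL y hε).symm
  have hRL := (Real.zero_at_infty_fourier fun s : ℝ ↦
    (triangle s : ℂ) * g (2 * Real.pi * s * Complex.I)).comp
    (tendsto_neg_atTop_atBot.mono_right atBot_le_cocompact)
  have h2 : Tendsto (fun y ↦ ((∫ t in Ioi (0 : ℝ), h t * fejer (t - y) : ℝ) : ℂ)) atTop (𝓝 0) := by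
    refine hRL.congr fun y ↦ ?_
    rw [key, Function.comp_apply, Real.fourier_real_eq_integral_exp_smul]
    refine integral_congr_ae (.of_forall fun s ↦ ?_)
    simp only [smul_eq_mul, mul_assoc]
    congr 2
    push_cast; ring
  have h3 := (Complex.continuous_re.tendsto 0).comp h2
  rw [Complex.zero_re] at h3
  exact h3.congr fun y ↦ Complex.ofReal_re _

lemma tendsto_integral_fejer_tail :
    Tendsto (fun R : ℝ ↦ ∫ u, {u | R < |u|}.indicator fejer u) atTop (𝓝 0) := by
  have hms (R : ℝ) : MeasurableSet {u : ℝ | R < |u|} :=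
    measurableSet_lt measurable_const measurable_norm
  rw [← integral_zero ℝ ℝ]
  refine tendsto_integral_filter_of_dominated_convergence fejer ?_ ?_ integrable_fejer ?_
  · exact .of_forall fun R ↦ (continuous_fejer.measurable.indicator (hms R)).aestronglyMeasurable
  · refine .of_forall fun R ↦ .of_forall fun u ↦ ?_
    refine (norm_indicator_le_norm_self _ _).trans_eq ?_
    exact Real.norm_of_nonneg (fejer_nonneg u)
  · refine .of_forall fun u ↦ tendsto_const_nhds.congr' ?_
    filter_upwards [eventually_ge_atTop |u|] with R hR
    rw [indicator_of_notMem]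
    exact not_lt.mpr hR

lemma le_integral_mul_fejer {h : ℝ → ℝ} (hm : Measurable h) {M : ℝ} (hM : ∀ t, |h t| ≤ M)
    {c y R : ℝ} (hR : R < y) (hc : ∀ t, |t - y| ≤ R → c ≤ h t) :
    c - (M + |c|) * ∫ u, {u | R < |u|}.indicator fejer u ≤
      ∫ t in Ioi (0 : ℝ), h t * fejer (t - y) := by
  have hms : MeasurableSet {u : ℝ | R < |u|} :=
    measurableSet_lt measurable_const measurable_norm
  have hI : Integrable ({u | R < |u|}.indicator fejer) := integrable_fejer.indicator hms
  have hM0 : 0 ≤ M := (abs_nonneg _).trans (hM 0)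
  have e1 : c - (M + |c|) * ∫ u, {u | R < |u|}.indicator fejer u =
      ∫ t, (c * fejer (t - y) - (M + |c|) * {u | R < |u|}.indicator fejer (t - y)) := by
    rw [integral_sub ((integrable_fejer.comp_sub_right y).const_mul c)
      ((hI.comp_sub_right y).const_mul _), integral_const_mul, integral_const_mul,
      integral_sub_right_eq_self fejer, integral_fejer, mul_one,
      integral_sub_right_eq_self ({u | R < |u|}.indicator fejer)]
  rw [e1, ← integral_indicator measurableSet_Ioi]
  refine integral_mono (((integrable_fejer.comp_sub_right y).const_mul c).sub
      ((hI.comp_sub_right y).const_mul _)) ?_ fun t ↦ ?_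
  · refine Integrable.indicator ?_ measurableSet_Ioi
    exact (integrable_fejer.comp_sub_right y).bdd_mul (c := M) hm.aestronglyMeasurable
      (.of_forall fun t ↦ by rw [Real.norm_eq_abs]; exact hM t)
  · have hK := fejer_nonneg (t - y)
    simp only
    by_cases ht : R < |t - y|
    · rw [indicator_of_mem (show t - y ∈ {u | R < |u|} from ht)]
      have h1 : -M ≤ h t := (abs_le.mp (hM t)).1
      have h2 := le_abs_self c
      by_cases h0 : t ∈ Ioi (0 : ℝ)
      · rw [indicator_of_mem h0]
        nlinarith
      · rw [indicator_of_notMem h0]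
        nlinarith [mul_nonneg hM0 hK]
    · rw [indicator_of_notMem (show t - y ∉ {u | R < |u|} from ht), indicator_of_mem]
      · nlinarith [hc t (not_lt.mp ht)]
      · have := (abs_le.mp (not_lt.mp ht)).1
        exact mem_Ioi.mpr (by linarith)

/-- A Tauberian theorem of Wiener–Ikehara type for the Laplace transform of a bounded function. -/
theorem tendsto_of_laplace {f : ℝ → ℝ} (hfm : Measurable f) (hf0 : ∀ t, 0 ≤ f t) {M : ℝ}
    (hfM : ∀ t, f t ≤ M) (hmono : Monotone fun t ↦ f t * Real.exp t) (a : ℝ)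
    {g : ℂ → ℂ} (hg : ContinuousOn g {z | 0 ≤ z.re})
    (hL : ∀ z : ℂ, 0 < z.re →
      ∫ t in Ioi (0 : ℝ), ((f t - a : ℝ) : ℂ) * Complex.exp (-z * t) = g z) :
    Tendsto f atTop (𝓝 a) := by
  have hM0 : 0 ≤ M := (hf0 0).trans (hfM 0)
  have hbd (t : ℝ) : |f t - a| ≤ M + |a| :=
    (abs_sub _ _).trans (by rw [abs_of_nonneg (hf0 t)]; linarith [hfM t])
  have hscale {b : ℝ} (hb : 0 < b) :
      Tendsto (fun y ↦ ∫ t in Ioi (0 : ℝ), (f (b * t) - a) * fejer (t - y)) atTop (𝓝 0) := by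
    refine tendsto_integral_mul_fejer (h := fun t ↦ f (b * t) - a) (M := M + |a|)
      (g := fun z ↦ (b : ℂ)⁻¹ * g (z / b)) (by fun_prop) (fun t ↦ hbd _) ?_ ?_
    · refine continuousOn_const.mul (hg.comp (by fun_prop) fun z hz ↦ ?_)
      simp only [mem_ofPred_eq, Complex.div_ofReal_re] at hz ⊢
      positivity
    · intro z hz
      have hb' : (b : ℂ) ≠ 0 := by exact_mod_cast hb.ne'
      have h1 := integral_comp_mul_left_Ioi
        (fun t : ℝ ↦ ((f t - a : ℝ) : ℂ) * Complex.exp (-(z / b) * t)) 0 hb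
      rw [mul_zero, hL (z / b) (by rw [Complex.div_ofReal_re]; positivity)] at h1
      simp only [Complex.real_smul, Complex.ofReal_inv] at h1
      rw [← h1]
      refine integral_congr_ae (.of_forall fun t ↦ ?_)
      simp only
      congr 2
      push_cast
      field_simp
  have hstep {x t d : ℝ} (hd : 0 ≤ d) (h1 : x ≤ t) (h2 : t ≤ x + d) : f x - d * M ≤ f t := by
    have h3 : f x * Real.exp x ≤ f t * Real.exp t := hmono h1
    have h4 : f x * Real.exp (x - t) ≤ f t := by
      rw [Real.exp_sub, mul_div_assoc', div_le_iff₀ (Real.exp_pos t)]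
      exact h3
    have h5 : 1 - d ≤ Real.exp (x - t) := by linarith [Real.add_one_le_exp (x - t)]
    nlinarith [hf0 x, hfM x]
  rw [Metric.tendsto_nhds]
  intro ε hε
  set δ : ℝ := ε / (8 * (M + 1)) with hδ
  have hδ0 : 0 < δ := by positivity
  have hδM : 2 * δ * M ≤ ε / 4 := by
    rw [hδ]; field_simp; linarith
  set B : ℝ := M + |a| + (M + |a| + 2 * δ * M) with hB
  have hB0 : 0 < B + 1 := by positivity
  obtain ⟨R, hτ, hR0⟩ := ((tendsto_integral_fejer_tail.eventually_lt_const
    (show (0 : ℝ) < ε / (4 * (B + 1)) by positivity)).and (eventually_gt_atTop 0)).exists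
  set τ := ∫ u, {u | R < |u|}.indicator fejer u
  have hτ0 : 0 ≤ τ := integral_nonneg fun u ↦ indicator_nonneg (fun u _ ↦ fejer_nonneg u) u
  have hτB : B * τ ≤ ε / 4 := by
    rw [lt_div_iff₀ (by positivity)] at hτ
    nlinarith
  set b : ℝ := δ / R with hb
  have hb0 : 0 < b := by positivity
  have hbR : b * R = δ := by rw [hb]; field_simp
  have hJ := (hscale hb0).eventually (Metric.ball_mem_nhds 0 (show 0 < ε / 4 by positivity))
  have t1 : Tendsto (fun x : ℝ ↦ (x + δ) / b) atTop atTop :=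
    (tendsto_atTop_add_const_right _ δ tendsto_id).atTop_div_const hb0
  have t2 : Tendsto (fun x : ℝ ↦ (x - δ) / b) atTop atTop :=
    (tendsto_atTop_add_const_right _ (-δ) tendsto_id).atTop_div_const hb0
  have habs {x s : ℝ} (hs : |s| ≤ 2 * δ * M) : |f x - a + s| ≤ M + |a| + 2 * δ * M :=
    (abs_add_le _ _).trans (add_le_add (hbd x) hs)
  have hs0 : |2 * δ * M| ≤ 2 * δ * M := (abs_of_nonneg (by positivity)).le
  filter_upwards [t1.eventually hJ, t2.eventually hJ, eventually_gt_atTop (2 * δ)]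
    with x hx1 hx2 hx
  rw [Real.dist_eq, sub_zero, abs_lt] at hx1 hx2
  rw [Real.dist_eq, abs_lt]
  constructor
  · have key := le_integral_mul_fejer (h := fun t ↦ -(f (b * t) - a)) (M := M + |a|)
      (c := -(f x - a + 2 * δ * M)) (y := (x - δ) / b) (R := R) (by fun_prop)
      (fun t ↦ by rw [abs_neg]; exact hbd _) (by rw [lt_div_iff₀ hb0]; linarith) fun t ht ↦ by
        have h1 := abs_le.mp ht
        have h2 : b * ((x - δ) / b) = x - δ := by field_simp
        have := hstep (x := b * t) (t := x) (d := 2 * δ) (by positivity) (by nlinarith)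
          (by nlinarith)
        linarith
    simp only [neg_mul, integral_neg, abs_neg] at key
    have := mul_le_mul_of_nonneg_right (add_le_add_right (habs (x := x) hs0) (M + |a|)) hτ0
    linarith [hx2.1]
  · have key := le_integral_mul_fejer (h := fun t ↦ f (b * t) - a) (M := M + |a|)
      (c := f x - a + -(2 * δ * M)) (y := (x + δ) / b) (R := R) (by fun_prop)
      (fun t ↦ hbd _) (by rw [lt_div_iff₀ hb0]; linarith) fun t ht ↦ by
        have h1 := abs_le.mp ht
        have h2 : b * ((x + δ) / b) = x + δ := by field_simp
        have := hstep (x := x) (t := b * t) (d := 2 * δ) (by positivity) (by nlinarith)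
          (by nlinarith)
        linarith
    have := mul_le_mul_of_nonneg_right (add_le_add_right
      (habs (x := x) (s := -(2 * δ * M)) (by rwa [abs_neg])) (M + |a|)) hτ0
    linarith [hx1.2]

section PrimeNumberTheorem

open ArithmeticFunction vonMangoldt Finset

variable {q : ℕ}

lemma sum_residueClass_le (a : ZMod q) {x : ℝ} (hx : 0 ≤ x) :
    ∑ k ∈ Icc 1 ⌊x⌋₊, residueClass a k ≤ (Real.log 4 + 4) * x := by
  refine le_trans ?_ (Chebyshev.psi_le_const_mul_self hx)
  rw [Chebyshev.psi, ← Finset.Icc_add_one_left_eq_Ioc, zero_add]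
  exact sum_le_sum fun k _ ↦ residueClass_le a k

lemma integral_sum_residueClass_exp (a : ZMod q) (z : ℂ) :
    ∫ t in Set.Ioi (0 : ℝ), (((∑ k ∈ Icc 1 ⌊Real.exp t⌋₊, residueClass a k) * Real.exp (-t) : ℝ)
        : ℂ) * Complex.exp (-z * t) =
      ∫ t in Set.Ioi (1 : ℝ), (∑ k ∈ Icc 1 ⌊t⌋₊, (residueClass a k : ℂ)) *
        (t : ℂ) ^ (-(1 + z + 1)) := by
  have himg : Real.exp '' Set.Ioi 0 = Set.Ioi 1 := by
    ext x
    constructor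
    · rintro ⟨t, ht, rfl⟩
      exact Real.one_lt_exp_iff.mpr ht
    · intro hx
      exact ⟨Real.log x, Real.log_pos hx, Real.exp_log (zero_lt_one.trans hx)⟩
  rw [← himg, integral_image_eq_integral_abs_deriv_smul measurableSet_Ioi
    (fun t _ ↦ (Real.hasDerivAt_exp t).hasDerivWithinAt) Real.exp_injective.injOn]
  refine integral_congr_ae (.of_forall fun t ↦ ?_)
  have hne : (Real.exp t : ℂ) ≠ 0 := by exact_mod_cast (Real.exp_pos t).ne'
  simp only [Real.abs_exp, Complex.real_smul]
  rw [Complex.cpow_def_of_ne_zero hne, ← Complex.ofReal_log (Real.exp_pos t).le, Real.log_exp]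
  push_cast
  have h : Complex.exp (-t) * Complex.exp (-z * t) =
      Complex.exp t * Complex.exp (t * -(1 + z + 1)) := by
    rw [← Complex.exp_add, ← Complex.exp_add]
    congr 1; ring
  linear_combination (∑ k ∈ Icc 1 ⌊Real.exp t⌋₊, (residueClass a k : ℂ)) * h

/-- The prime number theorem in arithmetic progressions, for the von Mangoldt function. -/
theorem tendsto_sum_residueClass_div [NeZero q] {a : ZMod q} (ha : IsUnit a) :
    Tendsto (fun n : ℕ ↦ (∑ k ∈ Icc 1 n, residueClass a k) / n) atTop
      (𝓝 (q.totient : ℝ)⁻¹) := by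
  set A : ℝ → ℝ := fun x ↦ ∑ k ∈ Icc 1 ⌊x⌋₊, residueClass a k with hA
  have hAmono : Monotone A := fun x y hxy ↦
    sum_le_sum_of_subset_of_nonneg (Icc_subset_Icc le_rfl (Nat.floor_mono hxy))
      fun k _ _ ↦ residueClass_nonneg a k
  have hA0 (x : ℝ) : 0 ≤ A x := sum_nonneg fun k _ ↦ residueClass_nonneg a k
  set f : ℝ → ℝ := fun t ↦ A (Real.exp t) * Real.exp (-t) with hf
  have hfm : Measurable f :=
    (hAmono.measurable.comp Real.measurable_exp).mul (by fun_prop)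
  have hf0 (t : ℝ) : 0 ≤ f t := mul_nonneg (hA0 _) (Real.exp_pos _).le
  have hfM (t : ℝ) : f t ≤ Real.log 4 + 4 := by
    calc f t ≤ (Real.log 4 + 4) * Real.exp t * Real.exp (-t) :=
          mul_le_mul_of_nonneg_right (sum_residueClass_le a (Real.exp_pos t).le)
            (Real.exp_pos _).le
      _ = _ := by rw [mul_assoc, ← Real.exp_add]; simp
  have hcont : ContinuousOn (fun z : ℂ ↦ (LFunctionResidueClassAux a (1 + z) - (q.totient : ℂ)⁻¹) /
      (1 + z)) {z | 0 ≤ z.re} := by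
    refine ContinuousOn.div (ContinuousOn.sub ?_ continuousOn_const) (by fun_prop) ?_
    · refine (continuousOn_LFunctionResidueClassAux a).comp (by fun_prop) fun z hz ↦ ?_
      simpa using hz
    · intro z hz h
      have := congrArg Complex.re h
      simp at this
      have hz' : 0 ≤ z.re := hz
      linarith
  have hlap (z : ℂ) (hz : 0 < z.re) :
      ∫ t in Set.Ioi (0 : ℝ), ((f t - (q.totient : ℝ)⁻¹ : ℝ) : ℂ) * Complex.exp (-z * t) =
        (LFunctionResidueClassAux a (1 + z) - (q.totient : ℂ)⁻¹) / (1 + z) := by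
    have hz0 : z ≠ 0 := fun h ↦ by simp [h] at hz
    have hz1 : 1 + z ≠ 0 := fun h ↦ by
      have := congrArg Complex.re h
      simp at this
      linarith
    have hre : 1 < (1 + z).re := by simpa using hz
    have hexp : IntegrableOn (fun t : ℝ ↦ Complex.exp (-z * t)) (Set.Ioi 0) :=
      integrableOn_exp_mul_complex_Ioi (by simpa using hz) 0
    have h_int : IntegrableOn (fun t : ℝ ↦ (f t : ℂ) * Complex.exp (-z * t)) (Set.Ioi 0) := by
      refine hexp.bdd_mul (c := Real.log 4 + 4)
        (Complex.measurable_ofReal.comp hfm).aestronglyMeasurable (.of_forall fun t ↦ ?_)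
      rw [Complex.norm_real, Real.norm_of_nonneg (hf0 t)]
      exact hfM t
    have hO : (fun n ↦ ∑ k ∈ Icc 1 n, residueClass a k) =O[atTop] fun n ↦ (n : ℝ) ^ (1 : ℝ) := by
      refine Asymptotics.IsBigO.of_bound (Real.log 4 + 4) (.of_forall fun n ↦ ?_)
      rw [Real.norm_of_nonneg (sum_nonneg fun k _ ↦ residueClass_nonneg a k), Real.rpow_one,
        Real.norm_of_nonneg n.cast_nonneg]
      simpa using sum_residueClass_le a n.cast_nonneg
    have hLS := LSeries_eq_mul_integral_of_nonneg (residueClass a) zero_le_one hre hO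
      (residueClass_nonneg a)
    rw [← integral_sum_residueClass_exp] at hLS
    have haux := eqOn_LFunctionResidueClassAux ha hre
    simp only at haux
    calc _ = (∫ t in Set.Ioi (0 : ℝ), (f t : ℂ) * Complex.exp (-z * t)) -
          ∫ t in Set.Ioi (0 : ℝ), (q.totient : ℂ)⁻¹ * Complex.exp (-z * t) := by
          rw [← integral_sub h_int (hexp.const_mul _)]
          refine integral_congr_ae (.of_forall fun t ↦ ?_)
          simp only
          push_cast; ring
      _ = _ := by
          rw [integral_const_mul, integral_exp_mul_complex_Ioi (by simpa using hz), haux, hLS]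
          simp only [Complex.ofReal_zero, mul_zero, Complex.exp_zero, add_sub_cancel_left]
          field_simp
          ring
  have hmono : Monotone fun t ↦ f t * Real.exp t := by
    have : (fun t ↦ f t * Real.exp t) = fun t ↦ A (Real.exp t) := by
      ext t
      rw [hf]
      simp only
      rw [mul_assoc, ← Real.exp_add]; simp
    rw [this]
    exact hAmono.comp Real.exp_monotone
  have key := tendsto_of_laplace hfm hf0 hfM hmono (q.totient : ℝ)⁻¹ hcont hlap
  refine (key.comp (Real.tendsto_log_atTop.comp tendsto_natCast_atTop_atTop)).congr' ?_
  filter_upwards [eventually_gt_atTop 0] with n hn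
  have hn' : (0 : ℝ) < n := by exact_mod_cast hn
  simp only [Function.comp_apply, hf, hA, Real.exp_log hn', Real.exp_neg, Nat.floor_natCast]
  rw [div_eq_mul_inv]

lemma tendsto_sum_mul_vonMangoldt_div [NeZero q] {c : ZMod q → ℝ}
    (hc : ∀ a, ¬ IsUnit a → c a = 0) :
    Tendsto (fun n : ℕ ↦ (∑ k ∈ Icc 1 n, c k * vonMangoldt k) / n) atTop
      (𝓝 (∑ a, c a * (q.totient : ℝ)⁻¹)) := by
  have h (a : ZMod q) : Tendsto (fun n : ℕ ↦ c a * ((∑ k ∈ Icc 1 n, residueClass a k) / n)) atTop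
      (𝓝 (c a * (q.totient : ℝ)⁻¹)) := by
    by_cases ha : IsUnit a
    · exact (tendsto_sum_residueClass_div ha).const_mul _
    · simp [hc a ha]
  refine (tendsto_finsetSum univ fun a _ ↦ h a).congr fun n ↦ ?_
  simp_rw [← mul_div_assoc]
  rw [← sum_div]
  congr 1
  simp_rw [mul_sum]
  rw [sum_comm]
  refine sum_congr rfl fun k _ ↦ ?_
  simp [Set.indicator_apply]

lemma tendsto_primeCounting_mul_log_sub_theta_div :
    Tendsto (fun n : ℕ ↦ ((n.primeCounting : ℝ) * Real.log n - Chebyshev.theta n) / n) atTop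
      (𝓝 0) := by
  obtain ⟨C, hC⟩ := (Chebyshev.primeCounting_sub_theta_div_log_isBigO.comp_tendsto
    tendsto_natCast_atTop_atTop).bound
  have hlog : Tendsto (fun n : ℕ ↦ Real.log n) atTop atTop :=
    Real.tendsto_log_atTop.comp tendsto_natCast_atTop_atTop
  have hb : Tendsto (fun n : ℕ ↦ C * (Real.log n)⁻¹) atTop (𝓝 0) := by
    simpa using hlog.inv_tendsto_atTop.const_mul C
  refine squeeze_zero_norm' ?_ hb
  filter_upwards [hC, eventually_gt_atTop 0, hlog.eventually_gt_atTop 0] with n h hn hl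
  have hn' : (0 : ℝ) < n := by exact_mod_cast hn
  simp only [Function.comp_apply, Nat.floor_natCast] at h
  rw [Real.norm_of_nonneg (show (0 : ℝ) ≤ n / Real.log n ^ 2 by positivity)] at h
  have e : ((n.primeCounting : ℝ) * Real.log n - Chebyshev.theta n) / n =
      (n.primeCounting - Chebyshev.theta n / Real.log n) * (Real.log n / n) := by
    field_simp
  rw [e, norm_mul, Real.norm_of_nonneg (show 0 ≤ Real.log n / n by positivity)]
  calc _ ≤ C * (n / Real.log n ^ 2) * (Real.log n / n) := by gcongr
    _ = _ := by field_simp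

lemma tendsto_psi_sub_theta_div :
    Tendsto (fun n : ℕ ↦ (Chebyshev.psi n - Chebyshev.theta n) / n) atTop (𝓝 0) := by
  obtain ⟨C, hC⟩ := Chebyshev.psi_sub_theta_le_mul_sqrt
  have hb : Tendsto (fun n : ℕ ↦ C * (√(n : ℝ))⁻¹) atTop (𝓝 0) := by
    simpa using ((Real.tendsto_sqrt_atTop.comp
      tendsto_natCast_atTop_atTop).inv_tendsto_atTop).const_mul C
  refine squeeze_zero' (.of_forall fun n ↦ div_nonneg
    (sub_nonneg.mpr (Chebyshev.theta_le_psi n)) n.cast_nonneg) ?_ hb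
  filter_upwards [eventually_gt_atTop 0] with n hn
  have hn' : (0 : ℝ) < n := by exact_mod_cast hn
  rw [div_le_iff₀ hn', mul_assoc]
  refine (hC n).trans_eq ?_
  congr 1
  rw [inv_mul_eq_div, Real.div_sqrt]

lemma eventually_le_primeCounting_mul_log :
    ∀ᶠ n : ℕ in atTop, (n : ℝ) / 4 ≤ n.primeCounting * Real.log n := by
  have h1 : Tendsto (fun n : ℕ ↦ Real.log ((n : ℝ) + 1) / n) atTop (𝓝 0) := by
    have := (Real.isLittleO_log_id_atTop.comp_tendsto
      (tendsto_atTop_add_const_right atTop (1 : ℝ) tendsto_natCast_atTop_atTop)).tendsto_div_nhds_zero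
    have h2 : Tendsto (fun n : ℕ ↦ ((n : ℝ) + 1) / n) atTop (𝓝 1) := by
      have : Tendsto (fun n : ℕ ↦ 1 + (n : ℝ)⁻¹) atTop (𝓝 (1 + 0)) :=
        tendsto_inv_atTop_nhds_zero_nat.const_add 1
      rw [add_zero] at this
      refine this.congr' ?_
      filter_upwards [eventually_gt_atTop 0] with n hn
      field_simp
    have h3 := this.mul h2
    rw [zero_mul] at h3
    refine h3.congr fun n ↦ ?_
    simp only [Function.comp_apply, id]
    field_simp
  filter_upwards [h1.eventually_lt_const (show (0 : ℝ) < 1 / 4 by norm_num),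
    eventually_gt_atTop 0] with n h hn
  have hn' : (0 : ℝ) < n := by exact_mod_cast hn
  rw [div_lt_iff₀ hn'] at h
  have := (Chebyshev.psi_ge n).trans (Chebyshev.psi_le_primeCounting_mul_log n)
  nlinarith [Real.log_two_gt_d9]

lemma primeCounting_eq_sum (n : ℕ) :
    (n.primeCounting : ℝ) = ∑ k ∈ Icc 1 n, if k.Prime then (1 : ℝ) else 0 := by
  rw [Nat.primeCounting, Nat.primeCounting', Nat.count_eq_card_filter_range, sum_boole]
  congr 2
  ext k
  simp only [mem_filter, Finset.mem_range, Finset.mem_Icc]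
  constructor
  · rintro ⟨h, hp⟩; exact ⟨⟨hp.one_le, by omega⟩, hp⟩
  · rintro ⟨h, hp⟩; exact ⟨by omega, hp⟩

/-- A function on residue classes, supported on the units and of mean value zero, has mean value
zero over the primes. -/
theorem tendsto_sum_prime_div_primeCounting [NeZero q] {c : ZMod q → ℝ}
    (hc : ∀ a, ¬ IsUnit a → c a = 0) (hc1 : ∀ a, |c a| ≤ 1) (hsum : ∑ a, c a = 0) :
    Tendsto (fun n : ℕ ↦ (∑ k ∈ Icc 1 n, if k.Prime then c k else 0) / n.primeCounting) atTop
      (𝓝 0) := by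
  have h1 := tendsto_sum_mul_vonMangoldt_div hc
  rw [← sum_mul, hsum, zero_mul] at h1
  have hlim := ((tendsto_primeCounting_mul_log_sub_theta_div.add
    tendsto_psi_sub_theta_div).add h1.abs).mul_const 4
  simp only [abs_zero, add_zero, zero_mul] at hlim
  refine squeeze_zero_norm' ?_ hlim
  filter_upwards [eventually_gt_atTop 1, eventually_le_primeCounting_mul_log] with n hn hπ
  have hn' : (0 : ℝ) < n := by exact_mod_cast (by omega : 0 < n)
  have hlog : 0 < Real.log n := Real.log_pos (by exact_mod_cast hn)
  have hπ0 : (0 : ℝ) < n.primeCounting :=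
    pos_of_mul_pos_left (lt_of_lt_of_le (by positivity) hπ) hlog.le
  set E : ℝ := ∑ k ∈ Icc 1 n, if k.Prime then c k else 0
  set V : ℝ := ∑ k ∈ Icc 1 n, c k * vonMangoldt k
  have hθ : Chebyshev.theta n = ∑ k ∈ Icc 1 n, if k.Prime then Real.log k else 0 := by
    rw [Chebyshev.theta, ← Finset.Icc_add_one_left_eq_Ioc, zero_add, Nat.floor_natCast, sum_filter]
  have hψ : Chebyshev.psi n = ∑ k ∈ Icc 1 n, vonMangoldt k := by
    rw [Chebyshev.psi, ← Finset.Icc_add_one_left_eq_Ioc, zero_add, Nat.floor_natCast]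
  have hEV : |E * Real.log n - V| ≤ (n.primeCounting * Real.log n - Chebyshev.theta n) +
      (Chebyshev.psi n - Chebyshev.theta n) := by
    rw [hθ, hψ, primeCounting_eq_sum, sum_mul, sum_mul, ← sum_sub_distrib, ← sum_sub_distrib,
      ← sum_sub_distrib, ← sum_add_distrib]
    refine (abs_sum_le_sum_abs _ _).trans (sum_le_sum fun k hk ↦ ?_)
    rw [Finset.mem_Icc] at hk
    have hk0 : (0 : ℝ) < k := by exact_mod_cast (by omega : 0 < k)
    have hkn : Real.log k ≤ Real.log n := Real.log_le_log hk0 (by exact_mod_cast hk.2)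
    by_cases hp : k.Prime
    · simp only [if_pos hp, vonMangoldt_apply_prime hp]
      rw [← mul_sub, abs_mul, abs_of_nonneg (sub_nonneg.mpr hkn)]
      nlinarith [hc1 k]
    · simp only [if_neg hp]
      rw [zero_mul, zero_sub, abs_neg, abs_mul, abs_of_nonneg vonMangoldt_nonneg]
      nlinarith [hc1 k, vonMangoldt_nonneg (n := k)]
  have hE : |E| * Real.log n ≤ (n.primeCounting * Real.log n - Chebyshev.theta n) +
      (Chebyshev.psi n - Chebyshev.theta n) + |V| := by
    have h3 : |E| * Real.log n = |E * Real.log n| := by rw [abs_mul, abs_of_pos hlog]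
    have h4 : |E * Real.log n| ≤ |E * Real.log n - V| + |V| := by
      simpa using abs_add_le (E * Real.log n - V) V
    linarith
  rw [Real.norm_eq_abs, abs_div, abs_of_pos hπ0, abs_div, abs_of_pos hn', ← add_div, ← add_div,
    div_mul_eq_mul_div, div_le_div_iff₀ hπ0 hn']
  refine le_of_mul_le_mul_right ?_ hlog
  have hR0 := (mul_nonneg (abs_nonneg E) hlog.le).trans hE
  calc |E| * n * Real.log n = |E| * Real.log n * n := by ring
    _ ≤ _ * (4 * (n.primeCounting * Real.log n)) :=
      mul_le_mul hE (by linarith) hn'.le hR0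
    _ = _ := by ring

end PrimeNumberTheorem

end Tauberian

section JacobiSymbol

theorem jacobiSym_abs_le_one (a : ℤ) (b : ℕ) : |(jacobiSym a b : ℝ)| ≤ 1 := by
  rcases jacobiSym.trichotomy a b with h | h | h <;> simp [h]

/-- A squarefree number other than `1` is a nonresidue for some odd Jacobi symbol. -/
theorem exists_jacobiSym_eq_neg_one {m : ℕ} (hm : Squarefree m) (hm1 : m ≠ 1) :
    ∃ b, Odd b ∧ jacobiSym m b = -1 := by
  by_cases h : ∃ p, p.Prime ∧ p ≠ 2 ∧ p ∣ m
  · obtain ⟨p, hp, hp2, k, rfl⟩ := h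
    have : Fact p.Prime := ⟨hp⟩
    have hpk : p.Coprime k := Nat.coprime_of_squarefree_mul hm
    have hodd : Odd p := hp.odd_of_ne_two hp2
    obtain ⟨r, hr⟩ := FiniteField.exists_nonsquare (F := ZMod p) (by rwa [ZMod.ringChar_zmod_n])
    have hcop : (4 * k).Coprime p := by
      refine Nat.Coprime.mul_left ?_ hpk.symm
      rw [show 4 = 2 ^ 2 by norm_num]
      exact Nat.Coprime.pow_left _ (Nat.coprime_two_left.mpr hodd)
    obtain ⟨b, hb1, hbr⟩ := Nat.chineseRemainder hcop 1 r.val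
    have hb4 : b % 4 = 1 := hb1.of_mul_right k
    have hbodd : Odd b := Nat.odd_iff.mpr (by omega)
    refine ⟨b, hbodd, ?_⟩
    have hk : jacobiSym k b = 1 := by
      rw [jacobiSym.mod_right' k hbodd, hb1, ← jacobiSym.mod_right' k odd_one,
        jacobiSym.one_right]
    have hpb : jacobiSym p b = -1 := by
      rw [jacobiSym.quadratic_reciprocity_one_mod_four' hodd hb4]
      refine ZMod.nonsquare_iff_jacobiSym_eq_neg_one.mpr ?_
      have : ((b : ℤ) : ZMod p) = r := by
        rw [Int.cast_natCast, (ZMod.natCast_eq_natCast_iff _ _ _).mpr hbr, ZMod.natCast_zmod_val]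
      rwa [this]
    rw [Nat.cast_mul, jacobiSym.mul_left, hpb, hk, mul_one]
  · push Not at h
    have hm2 : m = 2 := by
      obtain ⟨p, hp, hpm⟩ := Nat.exists_prime_and_dvd hm1
      have hp2 : p = 2 := by
        by_contra hne
        exact h p hp hne hpm
      subst hp2
      obtain ⟨k, rfl⟩ := hpm
      have hk : k = 1 := by
        by_contra hk
        obtain ⟨l, hl, hlk⟩ := Nat.exists_prime_and_dvd hk
        by_cases hl2 : l = 2
        · have := Nat.coprime_of_squarefree_mul hm
          rw [hl2] at hlk
          exact absurd (Nat.eq_one_of_dvd_coprimes this dvd_rfl hlk) (by norm_num)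
        · exact h l hl hl2 (hlk.mul_left 2)
      rw [hk]
    subst hm2
    refine ⟨3, by decide, ?_⟩
    norm_num

/-- The Jacobi symbol `(m | ·)` as a function on residue classes modulo `4 * m`. -/
noncomputable def jacobiMod (m : ℕ) (a : ZMod (4 * m)) : ℝ :=
  if IsUnit a then (jacobiSym m a.val : ℝ) else 0

theorem odd_of_coprime_four_mul {m b : ℕ} (h : b.Coprime (4 * m)) : Odd b := by
  have h4 : b.Coprime (2 ^ 2) := Nat.Coprime.coprime_mul_right_right h
  exact Nat.coprime_two_right.mp (Nat.Coprime.coprime_mul_right_right (k := 2) h4)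

theorem jacobiMod_natCast {m b : ℕ} (h : b.Coprime (4 * m)) :
    jacobiMod m b = jacobiSym m b := by
  rw [jacobiMod, if_pos ((ZMod.isUnit_iff_coprime _ _).mpr h), ZMod.val_natCast,
    jacobiSym.mod_right (m : ℤ) (odd_of_coprime_four_mul h), Int.natAbs_natCast]

theorem jacobiMod_mul {m : ℕ} [NeZero m] {u : ℕ} (hu : u.Coprime (4 * m)) (a : ZMod (4 * m)) :
    jacobiMod m (u * a) = jacobiSym m u * jacobiMod m a := by
  have hu' : IsUnit (u : ZMod (4 * m)) := (ZMod.isUnit_iff_coprime _ _).mpr hu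
  by_cases ha : IsUnit a
  · have hac : a.val.Coprime (4 * m) := by
      rw [← ZMod.isUnit_iff_coprime, ZMod.natCast_zmod_val]; exact ha
    have hne : ∀ {b : ℕ}, b.Coprime (4 * m) → b ≠ 0 := fun h hb ↦ by
      have := odd_of_coprime_four_mul h
      rw [hb] at this
      exact absurd this (by decide)
    have h1 : (u : ZMod (4 * m)) * a = ((u * a.val : ℕ) : ZMod (4 * m)) := by
      rw [Nat.cast_mul, ZMod.natCast_zmod_val]
    have h2 := jacobiMod_natCast hac
    rw [ZMod.natCast_zmod_val] at h2
    have : NeZero u := ⟨hne hu⟩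
    have : NeZero a.val := ⟨hne hac⟩
    rw [h1, jacobiMod_natCast (hu.mul_left hac), h2, jacobiSym.mul_right, Int.cast_mul]
  · have : ¬ IsUnit ((u : ZMod (4 * m)) * a) := fun h ↦ ha (isUnit_of_mul_isUnit_right h)
    rw [jacobiMod, if_neg this, jacobiMod, if_neg ha, mul_zero]

theorem sum_jacobiMod {m : ℕ} [NeZero m] (hm : Squarefree m) (hm1 : m ≠ 1) :
    ∑ a, jacobiMod m a = 0 := by
  obtain ⟨b, hb, hJ⟩ := exists_jacobiSym_eq_neg_one hm hm1
  have hbm : b.Coprime m := by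
    have : NeZero b := ⟨hb.pos.ne'⟩
    by_contra h
    have := (jacobiSym.eq_zero_iff_not_coprime (a := m) (b := b)).mpr (by
      rwa [Int.gcd_natCast_natCast, Nat.gcd_comm])
    omega
  have hcop : b.Coprime (4 * m) := by
    refine Nat.Coprime.mul_right ?_ hbm
    rw [show 4 = 2 ^ 2 by norm_num]
    exact Nat.Coprime.pow_right _ (Nat.coprime_two_right.mpr hb)
  have hu : IsUnit (b : ZMod (4 * m)) := (ZMod.isUnit_iff_coprime _ _).mpr hcop
  have h1 : ∑ a, jacobiMod m a = ∑ a, jacobiMod m (b * a) :=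
    (Equiv.sum_comp (hu.unit.mulLeft) (jacobiMod m)).symm
  simp only [jacobiMod_mul hcop, hJ, ← Finset.mul_sum] at h1
  push_cast at h1
  linarith

open Filter Topology in
/-- If `m ≠ 1` is squarefree, then `m` is a residue as often as a nonresidue. -/
theorem tendsto_sum_jacobiMod_div_primeCounting {m : ℕ} (hm : Squarefree m) (hm1 : m ≠ 1) :
    Tendsto (fun n : ℕ ↦ (∑ k ∈ Finset.Icc 1 n, if k.Prime then jacobiMod m k else 0) /
      n.primeCounting) atTop (𝓝 0) := by
  have : NeZero m := ⟨hm.ne_zero⟩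
  refine tendsto_sum_prime_div_primeCounting (fun a ha ↦ if_neg ha) (fun a ↦ ?_)
    (sum_jacobiMod hm hm1)
  unfold jacobiMod
  split_ifs
  · exact jacobiSym_abs_le_one _ _
  · simp

end JacobiSymbol

section QuadraticResidueDensity

open Filter Topology in
theorem tendsto_const_div_primeCounting (C : ℝ) :
    Tendsto (fun n : ℕ ↦ C / n.primeCounting) atTop (𝓝 0) :=
  tendsto_const_nhds.div_atTop (tendsto_natCast_atTop_atTop.comp Nat.tendsto_primeCounting)

open Filter Topology in
/-- A set of primes whose indicator agrees, away from the divisors of `N`, with a bounded function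
of mean value `δ` over the primes has density `δ`. -/
theorem hasPrimeDensity_of_tendsto {P : Set ℕ} (hP : ∀ p ∈ P, p.Prime) {f : ℕ → ℝ} {N : ℕ}
    (hN : N ≠ 0) (hf : ∀ p, p.Prime → ¬ p ∣ N → f p = if p ∈ P then 1 else 0)
    (hf1 : ∀ p, |f p| ≤ 1) {δ : ℝ}
    (hlim : Tendsto (fun n : ℕ ↦ (∑ k ∈ Finset.Icc 1 n, if k.Prime then f k else 0) /
      n.primeCounting) atTop (𝓝 δ)) : HasPrimeDensity P δ := by
  have hπ (n : ℕ) : ({p | Nat.Prime p ∧ p ≤ n}.ncard : ℝ) = n.primeCounting := by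
    rw [primeCounting_eq_sum, ← Finset.sum_filter, Finset.sum_const, nsmul_one,
      ← Set.ncard_coe_finset]
    congr 2
    ext p
    simp only [Set.mem_ofPred_eq, Finset.coe_filter, Finset.mem_Icc]
    exact ⟨fun h ↦ ⟨⟨h.1.one_le, h.2⟩, h.1⟩, fun h ↦ ⟨h.2, h.1.2⟩⟩
  have hcount (n : ℕ) : ({p ∈ P | p ≤ n}.ncard : ℝ) =
      ∑ k ∈ Finset.Icc 1 n, if k.Prime then if k ∈ P then (1 : ℝ) else 0 else 0 := by
    rw [← Finset.sum_filter, ← Finset.sum_filter, Finset.sum_const, nsmul_one,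
      ← Set.ncard_coe_finset]
    congr 2
    ext p
    simp only [Set.mem_ofPred_eq, Finset.coe_filter, Finset.mem_Icc, Finset.mem_filter]
    exact ⟨fun h ↦ ⟨⟨⟨(hP p h.1).one_le, h.2⟩, hP p h.1⟩, h.1⟩, fun h ↦ ⟨h.2, h.1.1.2⟩⟩
  unfold HasPrimeDensity
  simp only [hπ, hcount]
  rw [← tendsto_sub_nhds_zero_iff] at hlim ⊢
  have hzero := tendsto_const_div_primeCounting (2 * N.divisors.card)
  have hdiff : Tendsto (fun n : ℕ ↦
      (∑ k ∈ Finset.Icc 1 n, if k.Prime then if k ∈ P then (1 : ℝ) else 0 else 0) /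
        n.primeCounting - (∑ k ∈ Finset.Icc 1 n, if k.Prime then f k else 0) / n.primeCounting)
      atTop (𝓝 0) := by
    refine squeeze_zero_norm (fun n ↦ ?_) hzero
    rw [← sub_div, ← Finset.sum_sub_distrib, norm_div, Real.norm_natCast]
    gcongr
    calc _ ≤ ∑ k ∈ Finset.Icc 1 n, if k ∣ N then (2 : ℝ) else 0 := by
          refine norm_sum_le_of_le _ fun k _ ↦ ?_
          by_cases hk : k.Prime
          · simp only [if_pos hk]
            by_cases hkN : k ∣ N
            · rw [if_pos hkN, Real.norm_eq_abs]
              refine (abs_sub _ _).trans ?_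
              have := hf1 k
              split_ifs
              · rw [abs_one]; linarith
              · rw [abs_zero]; linarith
            · rw [hf k hk hkN, sub_self, norm_zero, if_neg hkN]
          · simp only [if_neg hk, sub_self, norm_zero]
            split_ifs <;> norm_num
      _ ≤ 2 * N.divisors.card := by
          rw [← Finset.sum_filter, Finset.sum_const, nsmul_eq_mul, mul_comm]
          gcongr
          intro k hk
          exact Nat.mem_divisors.mpr ⟨(Finset.mem_filter.mp hk).2, hN⟩
  have := hdiff.add hlim
  simpa using this

theorem jacobiSym_prod_left {ι : Type*} (s : Finset ι) (f : ι → ℤ) (b : ℕ) :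
    jacobiSym (∏ i ∈ s, f i) b = ∏ i ∈ s, jacobiSym (f i) b := by
  induction s using Finset.cons_induction with
  | empty => simp [jacobiSym.one_left]
  | cons i s hi ih => rw [Finset.prod_cons, Finset.prod_cons, jacobiSym.mul_left, ih]

theorem jacobiSym_sq_eq_one {a p : ℕ} (hp : p.Prime) (h : ¬ p ∣ a) : jacobiSym a p ^ 2 = 1 :=
  jacobiSym.sq_one (by
    rw [Int.gcd_natCast_natCast]; exact ((Nat.Prime.coprime_iff_not_dvd hp).mpr h).symm)

theorem jacobiSym_eq_prod_piOdd {z p : ℕ} (hz : z ≠ 0) (hp : p.Prime) (hpz : ¬ p ∣ z) :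
    jacobiSym z p = ∏ q ∈ piOdd z, jacobiSym q p := by
  conv_lhs => rw [← Nat.prod_factorization_pow_eq_self hz, Finsupp.prod, Nat.cast_prod,
    jacobiSym_prod_left]
  rw [piOdd, Finset.prod_filter, Nat.support_factorization]
  refine Finset.prod_congr rfl fun q hq ↦ ?_
  have hq' : jacobiSym q p ^ 2 = 1 :=
    jacobiSym_sq_eq_one hp fun h ↦ hpz (h.trans (Nat.dvd_of_mem_primeFactors hq))
  rw [Nat.cast_pow, jacobiSym.pow_left, pow_eq_pow_mod _ hq']
  split_ifs with h
  · rw [Nat.odd_iff.mp h, pow_one]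
  · rw [Nat.even_iff.mp (Nat.not_odd_iff_even.mp h), pow_zero]

/-- The product of the `a i` over the support of the vector `v` over the field of two elements. -/
def supportProd {ι : Type*} [Fintype ι] (a : ι → ℕ) (v : ι → ZMod 2) : ℕ :=
  ∏ i, a i ^ (v i).val

variable {ι : Type*} [Fintype ι] {a : ι → ℕ}

theorem squarefree_supportProd (ha : ∀ i, (a i).Prime) (hinj : Function.Injective a)
    (v : ι → ZMod 2) : Squarefree (supportProd a v) := by
  refine Finset.squarefree_prod_of_pairwise_isCoprime (fun i _ j _ hij ↦ ?_) fun i _ ↦ ?_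
  · exact Nat.coprime_iff_isRelPrime.mp
      (((Nat.coprime_primes (ha i) (ha j)).mpr (hinj.ne hij)).pow _ _)
  · have h2 := ZMod.val_lt (v i)
    interval_cases (v i).val
    · simp
    · simpa using (ha i).squarefree

theorem supportProd_ne_one (ha : ∀ i, (a i).Prime) {v : ι → ZMod 2} (hv : v ≠ 0) :
    supportProd a v ≠ 1 := by
  intro h
  apply hv
  ext1 i
  have := Finset.dvd_prod_of_mem (fun i ↦ a i ^ (v i).val) (Finset.mem_univ i)
  rw [show ∏ i, a i ^ (v i).val = 1 from h, Nat.dvd_one] at this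
  rw [Pi.zero_apply, ← ZMod.val_eq_zero]
  by_contra h0
  exact (ha i).one_lt.ne' ((Nat.pow_eq_one.mp this).resolve_right h0)

theorem jacobiSym_supportProd (v : ι → ZMod 2) (p : ℕ) :
    jacobiSym (supportProd a v) p = ∏ i, jacobiSym (a i) p ^ (v i).val := by
  rw [supportProd, Nat.cast_prod, jacobiSym_prod_left]
  simp only [Nat.cast_pow, jacobiSym.pow_left]

theorem jacobiSym_supportProd_add {p : ℕ} (h : ∀ i, jacobiSym (a i) p ^ 2 = 1)
    (v w : ι → ZMod 2) : jacobiSym (supportProd a (v + w)) p =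
      jacobiSym (supportProd a v) p * jacobiSym (supportProd a w) p := by
  simp only [jacobiSym_supportProd, ← Finset.prod_mul_distrib, Pi.add_apply, ZMod.val_add,
    ← pow_add]
  exact Finset.prod_congr rfl fun i _ ↦ (pow_eq_pow_mod _ (h i)).symm

/-- Orthogonality: the average of `(supportProd a v | p)` over the span of `s` detects whether it
is `1` on `s`. -/
theorem sum_jacobiSym_supportProd {p : ℕ} (h : ∀ i, jacobiSym (a i) p ^ 2 = 1)
    {s : Set (ι → ZMod 2)} {V : Submodule (ZMod 2) (ι → ZMod 2)} [Fintype V]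
    (hV : V = Submodule.span (ZMod 2) s) :
    ∑ v : V, (jacobiSym (supportProd a v) p : ℝ) =
      if ∀ v ∈ s, jacobiSym (supportProd a v) p = 1 then
        2 ^ Module.finrank (ZMod 2) V else 0 := by
  have h0 : jacobiSym (supportProd a (0 : ι → ZMod 2)) p = 1 := by simp [jacobiSym_supportProd]
  let ψ : AddChar V ℝ :=
    { toFun v := jacobiSym (supportProd a v) p
      map_zero_eq_one' := by simp [h0]
      map_add_eq_mul' v w := by
        rw [Submodule.coe_add, jacobiSym_supportProd_add h, Int.cast_mul] }
  have hsum : ∑ v : V, (jacobiSym (supportProd a v) p : ℝ) = ∑ v, ψ v := rfl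
  have hiff : ψ = 0 ↔ ∀ v ∈ s, jacobiSym (supportProd a v) p = 1 := by
    constructor
    · intro hψ v hv
      have : (jacobiSym (supportProd a v) p : ℝ) = 1 :=
        DFunLike.congr_fun hψ (⟨v, hV ▸ Submodule.subset_span hv⟩ : V)
      exact_mod_cast this
    · intro hs
      ext ⟨v, hv⟩
      suffices jacobiSym (supportProd a v) p = 1 by
        change (jacobiSym (supportProd a v) p : ℝ) = 1
        exact_mod_cast this
      rw [hV] at hv
      induction hv using Submodule.span_induction with
      | mem v hv => exact hs v hv
      | zero => exact h0
      | add v w _ _ hv hw => rw [jacobiSym_supportProd_add h, hv, hw, one_mul]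
      | smul c v _ hv =>
        have hc : ∀ c : ZMod 2, c = 0 ∨ c = 1 := by decide
        obtain rfl | rfl := hc c
        · rwa [zero_smul]
        · rwa [one_smul]
  rw [hsum, AddChar.sum_eq_ite]
  simp only [hiff]
  split_ifs
  · rw [← Nat.card_eq_fintype_card, Module.natCard_eq_pow_finrank (K := ZMod 2)]
    simp
  · rfl

theorem jacobiSym_supportProd_indVec {A X : Finset ℕ} {n : ℕ} (hn : A.card = n) (hX : X ⊆ A)
    (p : ℕ) : jacobiSym (supportProd (fun i ↦ (A.orderIsoOfFin hn i : ℕ)) (indVec A hn X)) p =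
      ∏ q ∈ X, jacobiSym q p := by
  have h (i : Fin n) : jacobiSym (A.orderIsoOfFin hn i : ℕ) p ^ (indVec A hn X i).val =
      (fun q : A ↦ if (q : ℕ) ∈ X then jacobiSym (q : ℕ) p else 1) (A.orderIsoOfFin hn i) := by
    unfold indVec
    split_ifs <;> simp_all [ZMod.val_one]
  rw [jacobiSym_supportProd, Finset.prod_congr rfl fun i _ ↦ h i]
  refine ((A.orderIsoOfFin hn).toEquiv.prod_comp
    (fun q : A ↦ if (q : ℕ) ∈ X then jacobiSym (q : ℕ) p else 1)).trans ?_
  rw [Finset.prod_coe_sort A (fun q : ℕ ↦ if q ∈ X then jacobiSym q p else 1),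
    ← Finset.prod_filter, Finset.filter_mem_eq_inter, Finset.inter_eq_right.mpr hX]

end QuadraticResidueDensity

/-- Let `S` be a nonempty finite set of positive integers,
`T = S \ {m² : m ≥ 1}`, `𝒯 = {π_odd(z) : z ∈ T}`, `A = ⋃ 𝒯`, `n = |A|`, and `d` the
dimension of the span of `v(𝒯)` in `F^n`. Then the set of odd primes `p`, not dividing any
element of `S`, such that `χ_p(z) = 1` for all `z ∈ S`, has density `2^(−d)` in the primes. -/
theorem density_of_all_quadratic_residues
    (S : Finset ℕ) (hS : S.Nonempty) (hpos : ∀ z ∈ S, 0 < z)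
    (T : Finset ℕ) (hT : T = S.filter (fun z => ¬ ∃ m : ℕ, 0 < m ∧ z = m * m))
    (𝒯 : Finset (Finset ℕ)) (h𝒯 : 𝒯 = T.image piOdd)
    (A : Finset ℕ) (hA : A = 𝒯.biUnion id)
    (n : ℕ) (hn : A.card = n)
    (d : ℕ)
    (hd : d = Module.finrank (ZMod 2)
      (Submodule.span (ZMod 2) (indVec A hn '' (↑𝒯 : Set (Finset ℕ))))) :
    HasPrimeDensity
      {p | p.Prime ∧ p ≠ 2 ∧ (∀ z ∈ S, ¬ p ∣ z) ∧ ∀ z ∈ S, jacobiSym (z : ℤ) p = 1}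
      ((2 : ℝ) ^ (-(d : ℤ))) := by
  have hmemA {q : ℕ} (hq : q ∈ A) : q.Prime ∧ ∃ z ∈ S, q ∣ z := by
    rw [hA, h𝒯, Finset.mem_biUnion] at hq
    obtain ⟨X, hX, hqX⟩ := hq
    obtain ⟨z, hz, rfl⟩ := Finset.mem_image.mp hX
    have hqz := (Finset.mem_filter.mp hqX).1
    rw [hT] at hz
    exact ⟨Nat.prime_of_mem_primeFactors hqz, z, (Finset.mem_filter.mp hz).1,
      Nat.dvd_of_mem_primeFactors hqz⟩
  set a : Fin n → ℕ := fun i ↦ (A.orderIsoOfFin hn i : ℕ) with ha_def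
  have haA (i : Fin n) : a i ∈ A := (A.orderIsoOfFin hn i).2
  have ha (i : Fin n) : (a i).Prime := (hmemA (haA i)).1
  have hinj : Function.Injective a :=
    Subtype.val_injective.comp (A.orderIsoOfFin hn).injective
  set s : Set (Fin n → ZMod 2) := indVec A hn '' (↑𝒯 : Set (Finset ℕ)) with hs_def
  set V := Submodule.span (ZMod 2) s with hV
  have hcard : Fintype.card V = 2 ^ d := by
    rw [← Nat.card_eq_fintype_card, Module.natCard_eq_pow_finrank (K := ZMod 2), hd]
    simp
  let c (v : V) (p : ℕ) : ℝ := if v = 0 then 1 else jacobiMod (supportProd a v) p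
  have hc1 (v : V) (p : ℕ) : |c v p| ≤ 1 := by
    simp only [c, jacobiMod]
    split_ifs
    · simp
    · exact jacobiSym_abs_le_one _ _
    · simp
  have hc (v : V) : Filter.Tendsto (fun x : ℕ ↦ (∑ k ∈ Finset.Icc 1 x,
      if k.Prime then c v k else 0) / x.primeCounting) Filter.atTop
      (nhds (if v = 0 then 1 else 0)) := by
    by_cases hv : v = 0
    · simp only [c, hv, if_true]
      refine tendsto_const_nhds.congr' ?_
      filter_upwards [Nat.tendsto_primeCounting.eventually_gt_atTop 0] with x hx
      rw [← primeCounting_eq_sum, div_self (by exact_mod_cast hx.ne')]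
    · simp only [c, hv, if_false]
      exact tendsto_sum_jacobiMod_div_primeCounting (squarefree_supportProd ha hinj _)
        (supportProd_ne_one ha fun h ↦ hv (Subtype.ext h))
  have hlim := (tendsto_finsetSum Finset.univ fun v _ ↦ hc v).const_mul ((2 : ℝ) ^ (-(d : ℤ)))
  rw [Finset.sum_ite_eq' Finset.univ (0 : V), if_pos (Finset.mem_univ _), mul_one] at hlim
  have hN : 2 * ∏ z ∈ S, z ≠ 0 :=
    mul_ne_zero two_ne_zero (Finset.prod_ne_zero_iff.mpr fun z hz ↦ (hpos z hz).ne')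
  refine hasPrimeDensity_of_tendsto (fun p hp ↦ hp.1) hN
    (f := fun p ↦ 2 ^ (-(d : ℤ)) * ∑ v, c v p) (fun p hp hpN ↦ ?_) (fun p ↦ ?_)
    (hlim.congr fun x ↦ ?_)
  · have hp2 : p ≠ 2 := fun h ↦ hpN (h ▸ dvd_mul_right _ _)
    have hpS (z : ℕ) (hz : z ∈ S) : ¬ p ∣ z := fun h ↦
      hpN ((h.trans (Finset.dvd_prod_of_mem _ hz)).mul_left 2)
    have hpa (i : Fin n) : ¬ p ∣ a i := fun h ↦ by
      obtain ⟨z, hz, hdvd⟩ := (hmemA (haA i)).2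
      exact hpS z hz (h.trans hdvd)
    have hcJ (v : V) : c v p = jacobiSym (supportProd a v) p := by
      by_cases hv : v = 0
      · simp [c, hv, jacobiSym_supportProd]
      · simp only [c, if_neg hv]
        refine jacobiMod_natCast ((Nat.Prime.coprime_iff_not_dvd hp).mpr fun h ↦ ?_)
        rcases (Nat.Prime.dvd_mul hp).mp h with h | h
        · exact hp2 ((Nat.prime_dvd_prime_iff_eq hp Nat.prime_two).mp
            (hp.dvd_of_dvd_pow (n := 2) h))
        · obtain ⟨i, -, hi⟩ := (Prime.dvd_finsetProd_iff hp.prime _).mp h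
          exact hpa i (hp.dvd_of_dvd_pow hi)
    simp only [hcJ]
    rw [sum_jacobiSym_supportProd (fun i ↦ jacobiSym_sq_eq_one hp (hpa i)) hV, ← hd]
    have hiff : (∀ v ∈ s, jacobiSym (supportProd a v) p = 1) ↔
        p ∈ {p | p.Prime ∧ p ≠ 2 ∧ (∀ z ∈ S, ¬ p ∣ z) ∧ ∀ z ∈ S, jacobiSym (z : ℤ) p = 1} := by
      have hT' : (∀ v ∈ s, jacobiSym (supportProd a v) p = 1) ↔
          ∀ z ∈ T, jacobiSym (z : ℤ) p = 1 := by
        rw [hs_def, Set.forall_mem_image, h𝒯, Finset.coe_image, Set.forall_mem_image]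
        refine forall₂_congr fun z hz ↦ ?_
        have hzS : z ∈ S := by
          rw [Finset.mem_coe, hT] at hz
          exact (Finset.mem_filter.mp hz).1
        have hsub : piOdd z ⊆ A := by
          rw [hA, h𝒯]
          exact Finset.subset_biUnion_of_mem id (Finset.mem_image_of_mem _ hz)
        rw [jacobiSym_supportProd_indVec hn hsub,
          ← jacobiSym_eq_prod_piOdd (hpos z hzS).ne' hp (hpS z hzS)]
      rw [hT', Set.mem_ofPred_eq]
      refine ⟨fun h ↦ ⟨hp, hp2, hpS, fun z hz ↦ ?_⟩, fun h z hz ↦ ?_⟩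
      · by_cases hzT : z ∈ T
        · exact h z hzT
        · rw [hT, Finset.mem_filter, not_and, not_not] at hzT
          obtain ⟨m, -, rfl⟩ := hzT hz
          rw [Nat.cast_mul, jacobiSym.mul_left, ← pow_two]
          exact jacobiSym_sq_eq_one hp fun hm ↦ hpS _ hz (hm.mul_left m)
      · rw [hT] at hz
        exact h.2.2.2 z (Finset.mem_filter.mp hz).1
    simp only [hiff]
    split_ifs
    · rw [zpow_neg, zpow_natCast, inv_mul_cancel₀ (by positivity)]
    · rw [mul_zero]
  · rw [abs_mul, abs_of_pos (by positivity), zpow_neg, zpow_natCast, inv_mul_le_iff₀ (by positivity),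
      mul_one]
    calc _ ≤ ∑ v : V, |c v p| := Finset.abs_sum_le_sum_abs _ _
      _ ≤ ∑ v : V, 1 := Finset.sum_le_sum fun v _ ↦ hc1 v p
      _ = 2 ^ d := by rw [Finset.sum_const, Finset.card_univ, hcard]; simp
  · rw [← Finset.sum_div, Finset.sum_comm, ← mul_div_assoc, Finset.mul_sum]
    congr 1
    refine Finset.sum_congr rfl fun k _ ↦ ?_
    split_ifs <;> simp
end

section
/- Let ℱ be a finite collection of nonempty sets, let ≃ be the equivalence relation on ℱ generated by nonempty intersection, with equivalence classes Λ_1, …, Λ_μ. Fix an element x contained in some member of ℱ, let ℳ_1 = {X ∈ ℱ : x ∈ X} (which is nonempty and contained in a single class Λ_{n_0}), and let ℳ_0 = ℱ \ ℳ_1. Consider the set 𝒫_∅(ℳ_0, 2) of 2-block partitions {P_1, P_2} of ℳ_0 that admit a labeling of blocks with 𝒰(ℳ_1 ∪ P_1) ∩ 𝒰(P_2) = ∅. Then: (i) if ℳ_1 ≠ Λ_{n_0}, the cardinality of 𝒫_∅(ℳ_0, 2) is 2^{μ−1} − 1; (ii) if ℳ_1 = Λ_{n_0} and μ ≥ 2,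 the cardinality of 𝒫_∅(ℳ_0, 2) is 2^{μ−2} − 1. -/
/-- The equivalence relation on a collection `F` of sets generated by nonempty intersection:
`Conn F X Y` holds iff `X = Y` or there is a chain `X = X_1, …, X_m = Y` of members of `F`
with `X_i ∩ X_{i+1} ≠ ∅` for all `i`. -/
def Conn {α : Type*} (F : Set (Set α)) : Set α → Set α → Prop :=
  Relation.EqvGen (fun A B => A ∈ F ∧ B ∈ F ∧ (A ∩ B).Nonempty)

/-- `Q` is a 2-block partition of `F`: two distinct nonempty blocks, pairwise disjoint,
whose union is `F`. -/
def IsTwoBlockPartition {β : Type*} (F : Set β) (Q : Set (Set β)) : Prop :=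
  Q.ncard = 2 ∧ (∀ P ∈ Q, P.Nonempty) ∧
    (∀ P ∈ Q, ∀ P' ∈ Q, P ≠ P' → Disjoint P P') ∧ ⋃₀ Q = F

theorem isTwoBlockPartition_pair_iff {β : Type*} {F P R : Set β} :
    IsTwoBlockPartition F {P, R} ↔
      P.Nonempty ∧ R.Nonempty ∧ Disjoint P R ∧ P ∪ R = F := by
  constructor
  · rintro ⟨hcard, hne, hdisj, hU⟩
    have hPR : P ≠ R := by
      rintro rfl
      simp at hcard
    refine ⟨hne P (by simp), hne R (by simp), hdisj P (by simp) R (by simp) hPR, ?_⟩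
    simpa using hU
  · rintro ⟨hP, hR, hdisj, hU⟩
    have hPR : P ≠ R := by
      rintro rfl
      exact hP.ne_empty (disjoint_self.mp hdisj)
    refine ⟨Set.ncard_pair hPR, ?_, ?_, by simpa using hU⟩
    · rintro A (rfl | rfl) <;> assumption
    · rintro A (rfl | rfl) B (rfl | rfl) hAB
      · exact absurd rfl hAB
      · exact hdisj
      · exact hdisj.symm
      · exact absurd rfl hAB

theorem Conn.of_mem {α : Type*} {F : Set (Set α)} {X Y : Set α} {a : α}
    (hX : X ∈ F) (hY : Y ∈ F) (haX : a ∈ X) (haY : a ∈ Y) : Conn F X Y :=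
  Relation.EqvGen.rel _ _ ⟨hX, hY, a, haX, haY⟩

/-- The class of `X` in `F` under `Conn F`. -/
def connClass {α : Type*} (F : Set (Set α)) (X : Set α) : Set (Set α) :=
  {Y ∈ F | Conn F X Y}

/-- The set of all classes of `F` under `Conn F`. -/
def connClasses {α : Type*} (F : Set (Set α)) : Set (Set (Set α)) :=
  {C | ∃ X ∈ F, C = connClass F X}

theorem mem_connClass_self {α : Type*} {F : Set (Set α)} {X : Set α} (hX : X ∈ F) :
    X ∈ connClass F X :=
  ⟨hX, Relation.EqvGen.refl X⟩

theorem connClass_eq_of_conn {α : Type*} {F : Set (Set α)} {X Y : Set α} (h : Conn F X Y) :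
    connClass F X = connClass F Y := by
  ext Z
  exact and_congr_right fun _ =>
    ⟨fun hZ => Relation.EqvGen.trans _ _ _ (Relation.EqvGen.symm _ _ h) hZ,
      fun hZ => Relation.EqvGen.trans _ _ _ h hZ⟩

theorem eq_connClass_of_mem {α : Type*} {F : Set (Set α)} {C : Set (Set α)} {Y : Set α}
    (hC : C ∈ connClasses F) (hY : Y ∈ C) : C = connClass F Y := by
  obtain ⟨X, -, rfl⟩ := hC
  exact connClass_eq_of_conn hY.2

theorem finite_connClasses {α : Type*} {F : Set (Set α)} (hF : F.Finite) :
    (connClasses F).Finite :=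
  (hF.image (connClass F)).subset fun _ ⟨X, hX, h⟩ => ⟨X, hX, h.symm⟩

/-- Taking unions is injective on sets of classes. -/
theorem injOn_sUnion_powerset_connClasses {α : Type*} {F : Set (Set α)} :
    Set.InjOn Set.sUnion (𝒫 (connClasses F)) := by
  have key : ∀ S ⊆ connClasses F, ∀ T ⊆ connClasses F, ⋃₀ S = ⋃₀ T → S ⊆ T := by
    intro S hS T hT h C hC
    obtain ⟨X, hX, rfl⟩ := hS hC
    obtain ⟨D, hD, hXD⟩ : X ∈ ⋃₀ T := h ▸ ⟨_, hC, mem_connClass_self hX⟩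
    exact eq_connClass_of_mem (hT hD) hXD ▸ hD
  exact fun S hS T hT h => (key S hS T hT h).antisymm (key T hT S hS h.symm)

/-- Two complementary parts of `F` have disjoint unions iff one of them is closed
under connectedness. -/
theorem disjoint_sUnion_iff_conn_closed {α : Type*} {F A B : Set (Set α)}
    (hAB : Disjoint A B) (hU : A ∪ B = F) :
    Disjoint (⋃₀ A) (⋃₀ B) ↔ ∀ X Y, Conn F X Y → (X ∈ B ↔ Y ∈ B) := by
  constructor
  · intro h X Y hXY
    have step : ∀ X Y, Y ∈ F → (X ∩ Y).Nonempty → X ∈ B → Y ∈ B := by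
      rintro X Y hY ⟨a, haX, haY⟩ hX
      rw [← hU] at hY
      refine hY.resolve_left fun hYA => ?_
      exact Set.disjoint_left.mp h ⟨Y, hYA, haY⟩ ⟨X, hX, haX⟩
    induction hXY with
    | rel X Y h => exact ⟨step X Y h.2.1 h.2.2, step Y X h.1 (Set.inter_comm X Y ▸ h.2.2)⟩
    | refl X => rfl
    | symm X Y _ ih => exact ih.symm
    | trans X Y Z _ _ ih₁ ih₂ => exact ih₁.trans ih₂
  · intro h
    rw [Set.disjoint_left]
    rintro a ⟨X, hX, haX⟩ ⟨Y, hY, haY⟩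
    have hc : Conn F X Y := Conn.of_mem (hU ▸ Or.inl hX) (hU ▸ Or.inr hY) haX haY
    exact Set.disjoint_left.mp hAB hX ((h X Y hc).mpr hY)

theorem ncard_nonempty_subsets {β : Type*} {E : Set β} (hE : E.Finite) :
    {S : Set β | S ⊆ E ∧ S.Nonempty}.ncard = 2 ^ E.ncard - 1 := by
  have : {S : Set β | S ⊆ E ∧ S.Nonempty} = 𝒫 E \ {∅} := by
    ext S
    simp [Set.nonempty_iff_ne_empty]
  rw [this, Set.ncard_sdiff_singleton_of_mem (by simp), Set.ncard_powerset E hE]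

/-- If every admissible partition has an admissible labeling with a fixed `w ∈ F \ M` in the first
block, admissible partitions correspond to nonempty sets of classes avoiding `M` and `w`. -/
theorem ncard_admissible_partitions {α : Type*} {F M : Set (Set α)} (hfin : F.Finite)
    {X₀ w : Set α} (hX₀ : X₀ ∈ M) (hM : M ⊆ connClass F X₀) (hw : w ∈ F \ M)
    (hlabel : ∀ P R : Set (Set α), IsTwoBlockPartition (F \ M) {P, R} →
      Disjoint (⋃₀ (M ∪ P)) (⋃₀ R) → w ∈ R → Disjoint (⋃₀ (M ∪ R)) (⋃₀ P)) :
    {Q : Set (Set (Set α)) | IsTwoBlockPartition (F \ M) Q ∧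
      ∃ P₁ P₂ : Set (Set α), Q = {P₁, P₂} ∧ Disjoint (⋃₀ (M ∪ P₁)) (⋃₀ P₂)}.ncard =
      2 ^ ((connClasses F \ {connClass F X₀}) \ {connClass F w}).ncard - 1 := by
  have hMF : M ⊆ F := fun X hX => (hM hX).1
  set E := (connClasses F \ {connClass F X₀}) \ {connClass F w}
  have hEfin : E.Finite := ((finite_connClasses hfin).sdiff).sdiff
  have hEsub : E ⊆ connClasses F := Set.sdiff_subset.trans Set.sdiff_subset
  have hsub : ∀ S ⊆ E, ⋃₀ S ⊆ F \ M := by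
    rintro S hS Y ⟨C, hC, hY⟩
    have hCY := eq_connClass_of_mem (hEsub (hS hC)) hY
    refine ⟨(hCY ▸ hY : Y ∈ connClass F Y).1, fun hYM => ?_⟩
    exact (hS hC).1.2 (hCY.trans (connClass_eq_of_conn (hM hYM).2).symm)
  have hwS : ∀ S ⊆ E, w ∉ ⋃₀ S := by
    rintro S hS ⟨C, hC, hwC⟩
    exact (hS hC).2 (eq_connClass_of_mem (hEsub (hS hC)) hwC)
  rw [← ncard_nonempty_subsets hEfin]
  symm
  refine Set.ncard_congr (fun S _ => {(F \ M) \ ⋃₀ S, ⋃₀ S}) ?_ ?_ ?_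
  · rintro S ⟨hS, C, hC⟩
    have hCne : (⋃₀ S).Nonempty := by
      obtain ⟨X, hX, rfl⟩ := hEsub (hS hC)
      exact ⟨X, _, hC, mem_connClass_self hX⟩
    refine ⟨isTwoBlockPartition_pair_iff.mpr
      ⟨⟨w, hw, hwS S hS⟩, hCne, Set.disjoint_sdiff_left, Set.sdiff_union_of_subset (hsub S hS)⟩,
      _, _, rfl, ?_⟩
    rw [disjoint_sUnion_iff_conn_closed (F := F)]
    · have closed : ∀ X Y, Conn F X Y → X ∈ ⋃₀ S → Y ∈ F → Y ∈ ⋃₀ S := by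
        rintro X Y hXY ⟨D, hD, hXD⟩ hY
        have hDX := eq_connClass_of_mem (hEsub (hS hD)) hXD
        exact ⟨D, hD, hDX ▸ ⟨hY, hXY⟩⟩
      have hF : ∀ X Y, Conn F X Y → (X ∈ F ↔ Y ∈ F) := by
        intro X Y hXY
        induction hXY with
        | rel X Y h => exact ⟨fun _ => h.2.1, fun _ => h.1⟩
        | refl X => rfl
        | symm X Y _ ih => exact ih.symm
        | trans X Y Z _ _ ih₁ ih₂ => exact ih₁.trans ih₂
      exact fun X Y hXY =>
        ⟨fun hX => closed X Y hXY hX ((hF X Y hXY).mp (hsub S hS hX).1),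
          fun hY => closed Y X (Relation.EqvGen.symm _ _ hXY) hY
            ((hF X Y hXY).mpr (hsub S hS hY).1)⟩
    · rw [Set.disjoint_union_left]
      exact ⟨Set.disjoint_left.mpr fun X hX hXS => (hsub S hS hXS).2 hX,
        Set.disjoint_sdiff_left⟩
    · rw [Set.union_assoc, Set.sdiff_union_of_subset (hsub S hS), Set.union_sdiff_cancel hMF]
  · rintro S T ⟨hS, -⟩ ⟨hT, -⟩ h
    refine injOn_sUnion_powerset_connClasses (hS.trans hEsub) (hT.trans hEsub) ?_
    have hmem : ⋃₀ S ∈ ({(F \ M) \ ⋃₀ T, ⋃₀ T} : Set (Set (Set α))) := by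
      rw [← h]
      simp
    refine hmem.resolve_left fun hST => hwS S hS ?_
    rw [hST]
    exact ⟨hw, hwS T hT⟩
  · rintro Q ⟨hQ, P₁, P₂, rfl, hdisj⟩
    obtain ⟨P, R, hPR, hdPR, hwP⟩ : ∃ P R : Set (Set α), ({P₁, P₂} : Set (Set (Set α))) = {P, R} ∧
        Disjoint (⋃₀ (M ∪ P)) (⋃₀ R) ∧ w ∉ R := by
      by_cases hw₂ : w ∈ P₂
      · exact ⟨P₂, P₁, Set.pair_comm _ _, hlabel _ _ hQ hdisj hw₂,
          Set.disjoint_right.mp (isTwoBlockPartition_pair_iff.mp hQ).2.2.1 hw₂⟩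
      · exact ⟨P₁, P₂, rfl, hdisj, hw₂⟩
    rw [hPR] at hQ ⊢
    obtain ⟨-, hR, hd, hU⟩ := isTwoBlockPartition_pair_iff.mp hQ
    have hRsub : R ⊆ F \ M := hU ▸ Set.subset_union_right
    have hcl := (disjoint_sUnion_iff_conn_closed (F := F)
      (Set.disjoint_union_left.mpr ⟨Set.disjoint_left.mpr fun X hX hXR => (hRsub hXR).2 hX, hd⟩)
      (by rw [Set.union_assoc, hU, Set.union_sdiff_cancel hMF])).mp hdPR
    have hclass : ∀ Y ∈ R, connClass F Y ∈ E ∧ connClass F Y ⊆ R := by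
      intro Y hY
      have hs : connClass F Y ⊆ R := fun Z hZ => (hcl Y Z hZ.2).mp hY
      refine ⟨⟨⟨⟨Y, (hRsub hY).1, rfl⟩, fun h => ?_⟩, fun h => ?_⟩, hs⟩
      · exact (hRsub (hs (h ▸ mem_connClass_self (hMF hX₀)))).2 hX₀
      · exact hwP (hs (h ▸ mem_connClass_self hw.1))
    have hRU : ⋃₀ (connClass F '' R) = R := by
      ext Z
      constructor
      · rintro ⟨_, ⟨Y, hY, rfl⟩, hZ⟩
        exact (hclass Y hY).2 hZ
      · exact fun hZ => ⟨_, ⟨Z, hZ, rfl⟩, mem_connClass_self (hRsub hZ).1⟩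
    refine ⟨connClass F '' R, ⟨?_, hR.image _⟩, ?_⟩
    · rintro _ ⟨Y, hY, rfl⟩
      exact (hclass Y hY).1
    · have : (F \ M) \ R = P := by
        rw [← hU, Set.union_sdiff_right, hd.sdiff_eq_left]
      simp only [hRU, this]

/-- Let `ℱ` be a finite collection of nonempty sets, with `μ` equivalence
classes under the equivalence relation generated by nonempty intersection. Fix an element `x`
lying in some member of `ℱ`, let `ℳ₁ = {X ∈ ℱ : x ∈ X}` (nonempty, contained in the single
class `Λ_{n₀} = C₀`) and `ℳ₀ = ℱ \ ℳ₁`. Let `𝒫_∅(ℳ₀, 2)` be the set of 2-block partitions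
`{P₁, P₂}` of `ℳ₀` admitting a labeling with `𝒰(ℳ₁ ∪ P₁) ∩ 𝒰(P₂) = ∅`. Then:
(i) if `ℳ₁ ≠ C₀` then `|𝒫_∅(ℳ₀, 2)| = 2^(μ−1) − 1`;
(ii) if `ℳ₁ = C₀` and `μ ≥ 2` then `|𝒫_∅(ℳ₀, 2)| = 2^(μ−2) − 1`. -/
theorem card_P_empty_M0
    {α : Type*} (F : Set (Set α)) (hfin : F.Finite) (hne : ∀ X ∈ F, X.Nonempty)
    (x : α) (X₀ : Set α) (hX₀ : X₀ ∈ F) (hxX₀ : x ∈ X₀)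
    (M1 M0 : Set (Set α)) (hM1 : M1 = {X ∈ F | x ∈ X}) (hM0 : M0 = F \ M1)
    (μ : ℕ) (hμ : μ = {C : Set (Set α) | ∃ X ∈ F, C = {Y ∈ F | Conn F X Y}}.ncard)
    (C₀ : Set (Set α)) (hC₀ : C₀ = {Y ∈ F | Conn F X₀ Y}) :
    (M1 ≠ C₀ →
      {Q : Set (Set (Set α)) | IsTwoBlockPartition M0 Q ∧
        ∃ P₁ P₂ : Set (Set α), Q = {P₁, P₂} ∧
          Disjoint (⋃₀ (M1 ∪ P₁)) (⋃₀ P₂)}.ncard = 2 ^ (μ - 1) - 1) ∧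
    (M1 = C₀ → 2 ≤ μ →
      {Q : Set (Set (Set α)) | IsTwoBlockPartition M0 Q ∧
        ∃ P₁ P₂ : Set (Set α), Q = {P₁, P₂} ∧
          Disjoint (⋃₀ (M1 ∪ P₁)) (⋃₀ P₂)}.ncard = 2 ^ (μ - 2) - 1) := by
  have hX₀M : X₀ ∈ M1 := hM1 ▸ ⟨hX₀, hxX₀⟩
  have hMC : M1 ⊆ connClass F X₀ := by
    rw [hM1]
    exact fun Y hY => ⟨hY.1, Conn.of_mem hX₀ hY.1 hxX₀ hY.2⟩
  have hμ' : μ = (connClasses F).ncard := hμ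
  have hC₀' : C₀ = connClass F X₀ := hC₀
  have hC₀mem : connClass F X₀ ∈ connClasses F := ⟨X₀, hX₀, rfl⟩
  have hcard : (connClasses F \ {connClass F X₀}).ncard = μ - 1 := by
    rw [Set.ncard_sdiff_singleton_of_mem hC₀mem, hμ']
  subst hM0
  constructor
  · intro hne₀
    obtain ⟨w, hwC, hwM⟩ : ∃ w ∈ connClass F X₀, w ∉ M1 := by
      by_contra! h
      exact hne₀ (hC₀' ▸ hMC.antisymm h)
    rw [ncard_admissible_partitions hfin hX₀M hMC ⟨hwC.1, hwM⟩,
      ← connClass_eq_of_conn hwC.2, Set.sdiff_sdiff, Set.union_self, hcard]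
    intro P R hPR hdisj hwR
    obtain ⟨-, -, hd, hU⟩ := isTwoBlockPartition_pair_iff.mp hPR
    have hRsub : R ⊆ F \ M1 := hU ▸ Set.subset_union_right
    have hcl := (disjoint_sUnion_iff_conn_closed (F := F)
      (Set.disjoint_union_left.mpr ⟨Set.disjoint_left.mpr fun X hX hXR => (hRsub hXR).2 hX, hd⟩)
      (by rw [Set.union_assoc, hU, Set.union_sdiff_cancel (hMC.trans fun _ h => h.1)])).mp hdisj
    exact absurd hX₀M (hRsub ((hcl X₀ w hwC.2).mpr hwR)).2
  · intro heq hμ2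
    have hM : M1 = connClass F X₀ := heq.trans hC₀'
    obtain ⟨C, ⟨w, hwF, rfl⟩, hCne⟩ : (connClasses F \ {connClass F X₀}).Nonempty :=
      Set.nonempty_of_ncard_ne_zero (by omega)
    have hwM : w ∉ M1 := by
      rw [hM]
      exact fun h => hCne (connClass_eq_of_conn h.2).symm
    rw [ncard_admissible_partitions hfin hX₀M hMC ⟨hwF, hwM⟩,
      Set.ncard_sdiff_singleton_of_mem
        (show _ ∈ connClasses F \ _ from ⟨⟨w, hwF, rfl⟩, hCne⟩), hcard, Nat.sub_sub]
    intro P R hPR hdisj _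
    obtain ⟨-, -, -, hU⟩ := isTwoBlockPartition_pair_iff.mp hPR
    rw [Set.sUnion_union, Set.disjoint_union_left] at hdisj ⊢
    refine ⟨Set.disjoint_left.mpr ?_, hdisj.2.symm⟩
    rintro a ⟨X, hX, haX⟩ ⟨Y, hY, haY⟩
    have hYM : Y ∈ F \ M1 := hU ▸ Or.inl hY
    rw [hM] at hX hYM
    exact hYM.2 ⟨hYM.1, Relation.EqvGen.trans _ _ _ hX.2 (Conn.of_mem hX.1 hYM.1 haX haY)⟩
end
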